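/- There exists a game space (X,d) whose underlying topological space is homeomorphic to the 3-sphere 𝕊³ = {x ∈ ℝ⁴ : |x| = 1} and whose cop number is infinite: for every k ∈ ℕ, k cops do not have a winning strategy on X. -/

import Mathlib

/-!
Game of Cops and Robber on metric spaces, following Mohar, formalized relative to an
explicit distance function `d : Y → Y → ℝ`.
-/

open Set Filter Topology

/-- The length of (the restriction to `[0,1]` of) a map `p : ℝ → Y` with respect to an
extended-real-valued cost function `c`, defined as the supremum over all finite monotone
partitions of `[0,1]` of the sums of the costs of consecutive points. -/
noncomputable def elen {Y : Type*} (c : Y → Y → ENNReal) (p : ℝ → Y) : ENNReal :=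
  ⨆ q : ℕ × {u : ℕ → ℝ // Monotone u ∧ ∀ i, u i ∈ Set.Icc (0 : ℝ) 1},
    ∑ i ∈ Finset.range q.1, c (p (q.2.1 i)) (p (q.2.1 (i + 1)))

/-- Continuity on `[0,1]` of a map `p : ℝ → Y` with respect to a cost function `c`,
stated in `ε`-`δ` form. -/
def econt {Y : Type*} (c : Y → Y → ENNReal) (p : ℝ → Y) : Prop :=
  ∀ t ∈ Set.Icc (0 : ℝ) 1, ∀ ε : ENNReal, 0 < ε →
    ∃ δ : ℝ, 0 < δ ∧ ∀ t' ∈ Set.Icc (0 : ℝ) 1, |t' - t| < δ → c (p t) (p t') < ε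

/-- `d` is a metric on `Y`. -/
def IsMetricD (Y : Type*) (d : Y → Y → ℝ) : Prop :=
  (∀ x, d x x = 0) ∧ (∀ x y, d x y = 0 → x = y) ∧
    (∀ x y, d x y = d y x) ∧ (∀ x y z, d x z ≤ d x y + d y z)

/-- Compactness of the metric space `(Y,d)`, in its sequential form: every sequence has a
convergent subsequence. -/
def CompactD (Y : Type*) (d : Y → Y → ℝ) : Prop :=
  ∀ u : ℕ → Y, ∃ (x : Y) (φ : ℕ → ℕ), StrictMono φ ∧
    Filter.Tendsto (fun n => d (u (φ n)) x) Filter.atTop (nhds 0)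

/-- `(Y,d)` is a geodesic metric space: any two points `x, y` are joined by a continuous
path `p : [0,1] → Y` whose length equals `d x y`. -/
def IsGeodesicD (Y : Type*) (d : Y → Y → ℝ) : Prop :=
  ∀ x y : Y, ∃ p : ℝ → Y,
    econt (fun a b => ENNReal.ofReal (d a b)) p ∧ p 0 = x ∧ p 1 = y ∧
      elen (fun a b => ENNReal.ofReal (d a b)) p = ENNReal.ofReal (d x y)

/-- A game space is a (nonempty) compact geodesic metric space. -/
def GameSpaceD (Y : Type*) (d : Y → Y → ℝ) : Prop :=
  Nonempty Y ∧ IsMetricD Y d ∧ CompactD Y d ∧ IsGeodesicD Y d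

/-- An agility function: positive, with divergent sum. -/
def IsAgility (τ : ℕ → ℝ) : Prop := (∀ n, 0 < τ n) ∧ ¬ Summable τ

/-- The trajectory of the `k` cops determined by initial positions `c0`, a cop strategy `σ`
(where `σ n` computes the cops' positions at step `n+1` from the robber's positions
`r^0, …, r^(n+1)`), and a robber trajectory `r`. -/
def copTraj {Y : Type*} {k : ℕ} (c0 : Fin k → Y)
    (σ : (n : ℕ) → (Fin (n + 2) → Y) → Fin k → Y) (r : ℕ → Y) : ℕ → Fin k → Y
  | 0 => c0
  | n + 1 => σ n fun i => r i

/-- The trajectory of the robber determined by his initial position `r0`, a robber strategy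
`ρ` (where `ρ n` computes the robber's position at step `n+1` from the cops' positions
`c^0, …, c^n`), and a cop trajectory `c`. -/
def robTraj {Y : Type*} {k : ℕ} (r0 : Y)
    (ρ : (n : ℕ) → (Fin (n + 1) → Fin k → Y) → Y) (c : ℕ → Fin k → Y) : ℕ → Y
  | 0 => r0
  | n + 1 => ρ n fun i => c i

/-- `k` cops have a winning strategy on `(Y,d)`: for every agility function and every initial
position chosen by the robber there is a cop strategy `σ`, assigning legal cop moves to every
history, such that against every legal robber trajectory the cops come arbitrarily close to
the robber. -/
def CopsWinWith (Y : Type*) (d : Y → Y → ℝ) (k : ℕ) : Prop :=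
  ∀ τ : ℕ → ℝ, IsAgility τ → ∀ r0 : Y, ∀ c0 : Fin k → Y,
    ∃ σ : (n : ℕ) → (Fin (n + 2) → Y) → Fin k → Y,
      ∀ r : ℕ → Y, r 0 = r0 → (∀ n, d (r n) (r (n + 1)) ≤ τ (n + 1)) →
        (∀ n i, d (copTraj c0 σ r n i) (copTraj c0 σ r (n + 1) i) ≤ τ (n + 1)) ∧
          (∀ ε : ℝ, 0 < ε → ∃ n i, d (r n) (copTraj c0 σ r n i) < ε)

/-- The cop number of `(Y,d)`, as an extended natural number: the least `k` such that `k`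
cops have a winning strategy (`⊤` if there is no such `k`). -/
noncomputable def copNumber (Y : Type*) (d : Y → Y → ℝ) : ℕ∞ :=
  sInf {m : ℕ∞ | ∃ k : ℕ, m = (k : ℕ∞) ∧ CopsWinWith Y d k}

/-- The robber has a strategy against `k` cops on `(Y,d)` with agility function `τ` which
guarantees that his moves are legal and that every cop always stays at distance `> ε` from
him, against every legal cop play. -/
def RobberWins (Y : Type*) (d : Y → Y → ℝ) (k : ℕ) (τ : ℕ → ℝ) (ε : ℝ) : Prop :=
  ∃ (r0 : Y) (c0 : Fin k → Y) (ρ : (n : ℕ) → (Fin (n + 1) → Fin k → Y) → Y),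
    ∀ c : ℕ → Fin k → Y, c 0 = c0 → (∀ n i, d (c n i) (c (n + 1) i) ≤ τ (n + 1)) →
      (∀ n, d (robTraj r0 ρ c n) (robTraj r0 ρ c (n + 1)) ≤ τ (n + 1)) ∧
        (∀ n i, ε < d (robTraj r0 ρ c n) (c n i))

/-- `x` and `y` are joined by a path of duration `C` along which every member of the family `f`
is `1`-Lipschitz. -/
def Joins {X ι : Type*} (f : ι → X → ℝ) (C : ℝ) (x y : X) : Prop :=
  0 ≤ C ∧ ∃ p : ℝ → X, p 0 = x ∧ p C = y ∧ ∀ i s t, |f i (p s) - f i (p t)| ≤ |s - t|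

namespace Joins

variable {X ι : Type*} {f : ι → X → ℝ} {A B C : ℝ} {x y z : X}

theorem refl (x : X) : Joins f 0 x x :=
  ⟨le_rfl, fun _ => x, rfl, rfl, fun i s t => by simp⟩

theorem symm (h : Joins f C x y) : Joins f C y x := by
  obtain ⟨hC, p, h0, h1, hp⟩ := h
  refine ⟨hC, fun t => p (C - t), by simpa using h1, by simpa using h0, fun i s t => ?_⟩
  refine (hp i _ _).trans_eq ?_
  rw [abs_sub_comm]
  congr 1
  ring

theorem mono (h : Joins f A x y) (hAB : A ≤ B) : Joins f B x y := by
  obtain ⟨hA, p, h0, h1, hp⟩ := h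
  refine ⟨hA.trans hAB, fun t => p (min t A), by simpa [hA] using h0,
    by simpa [hAB] using h1, fun i s t => (hp i _ _).trans ?_⟩
  simpa using abs_min_sub_min_le_max s A t A

theorem trans (h : Joins f A x y) (h' : Joins f B y z) : Joins f (A + B) x z := by
  obtain ⟨hA, p, p0, p1, hp⟩ := h
  obtain ⟨hB, q, q0, q1, hq⟩ := h'
  have key : ∀ i s t, s ≤ A → A < t → |f i (p s) - f i (q (t - A))| ≤ |s - t| := by
    intro i s t hs ht
    have h1 := hp i s A
    have h2 := hq i 0 (t - A)
    rw [p1] at h1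
    rw [q0] at h2
    rw [abs_sub_comm s, abs_of_nonneg (sub_nonneg.2 hs)] at h1
    rw [zero_sub, abs_neg, abs_of_pos (sub_pos.2 ht)] at h2
    rw [abs_sub_comm s, abs_of_nonneg (by linarith : 0 ≤ t - s)]
    have := _root_.abs_sub_le (f i (p s)) (f i y) (f i (q (t - A)))
    linarith
  refine ⟨add_nonneg hA hB, fun t => if t ≤ A then p t else q (t - A), by simp [hA, p0], ?_, ?_⟩
  · rcases hB.eq_or_lt with rfl | hB
    · simp [p1, ← q1, q0]
    · simp [hB, q1]
  · intro i s t
    dsimp only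
    split_ifs with hs ht ht
    · exact hp i s t
    · exact key i s t hs (not_le.1 ht)
    · rw [abs_sub_comm, abs_sub_comm s]
      exact key i t s ht (not_le.1 hs)
    · simpa using hq i (s - A) (t - A)

theorem abs_sub_le (h : Joins f C x y) (i : ι) : |f i x - f i y| ≤ C := by
  obtain ⟨hC, p, h0, h1, hp⟩ := h
  simpa [h0, h1, abs_of_nonneg hC] using hp i 0 C

/-- A path on the unit interval along which the family is `C`-Lipschitz, reparametrized. -/
theorem of_unitInterval (hC : 0 < C) (γ : ℝ → X) (h0 : γ 0 = x) (h1 : γ 1 = y)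
    (hγ : ∀ i, ∀ s ∈ Icc (0 : ℝ) 1, ∀ t ∈ Icc (0 : ℝ) 1,
      |f i (γ s) - f i (γ t)| ≤ C * |s - t|) : Joins f C x y := by
  refine ⟨hC.le, fun t => γ (projIcc (0 : ℝ) 1 (zero_le_one' ℝ) (t / C)), by simp [projIcc, h0],
    by simp [projIcc, hC.ne', h1], fun i s t => ?_⟩
  refine (hγ i _ (Subtype.prop _) _ (Subtype.prop _)).trans ?_
  calc C * |(projIcc (0 : ℝ) 1 (zero_le_one' ℝ) (s / C) : ℝ) -
        projIcc (0 : ℝ) 1 (zero_le_one' ℝ) (t / C)|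
      ≤ C * |s / C - t / C| := by
        exact mul_le_mul_of_nonneg_left (abs_projIcc_sub_projIcc (zero_le_one' ℝ)) hC.le
    _ = |s - t| := by
        rw [← sub_div, abs_div, abs_of_pos hC]
        field_simp

end Joins

/-- The intrinsic distance determined by a family of functions. -/
noncomputable def intrinsicDist {X ι : Type*} (f : ι → X → ℝ) (x y : X) : ℝ :=
  sInf {C | Joins f C x y}

section Intrinsic

variable {X ι : Type*} {f : ι → X → ℝ}

theorem bddBelow_joins (x y : X) : BddBelow {C | Joins f C x y} := ⟨0, fun _ h => h.1⟩

theorem Joins.intrinsicDist_le {C : ℝ} {x y : X} (h : Joins f C x y) : intrinsicDist f x y ≤ C :=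
  csInf_le (bddBelow_joins x y) h

theorem joins_intrinsicDist [TopologicalSpace X] [CompactSpace X] (hf : ∀ i, Continuous (f i))
    (hsep : ∀ x y, (∀ i, f i x = f i y) → x = y) {x y : X} (hxy : ∃ C, Joins f C x y) :
    Joins f (intrinsicDist f x y) x y := by
  set D := intrinsicDist f x y with hD
  have hD0 : 0 ≤ D := le_csInf hxy fun C h => h.1
  have hn : ∀ n : ℕ, Joins f (D + 1 / ((n : ℝ) + 1)) x y := fun n => by
    obtain ⟨C, hC, hlt⟩ := exists_lt_of_csInf_lt (s := {C | Joins f C x y}) hxy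
      (lt_add_of_pos_right D (Nat.one_div_pos_of_nat (n := n)))
    exact Joins.mono hC hlt.le
  choose p p0 p1 hp using fun n => (hn n).2
  let 𝒰 : Ultrafilter ℕ := hyperfilter ℕ
  have hlim : ∀ t, ∃ z, Tendsto (fun n => p n t) 𝒰 (𝓝 z) := fun t => by
    obtain ⟨z, -, hz⟩ := isCompact_univ.ultrafilter_le_nhds (𝒰.map fun n => p n t) (by simp)
    exact ⟨z, hz⟩
  choose P hP using hlim
  have hfP : ∀ i t, Tendsto (fun n => f i (p n t)) 𝒰 (𝓝 (f i (P t))) := fun i t =>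
    ((hf i).tendsto _).comp (hP t)
  have hatTop : (𝒰 : Filter ℕ) ≤ atTop := Nat.hyperfilter_le_atTop
  refine ⟨hD0, P, hsep _ _ fun i => ?_, hsep _ _ fun i => ?_, fun i s t => ?_⟩
  · exact tendsto_nhds_unique (hfP i 0) (by simp [p0])
  · have h1 : Tendsto (fun n : ℕ => |f i (p n D) - f i y|) 𝒰 (𝓝 0) := by
      refine squeeze_zero (fun _ => abs_nonneg _) (fun n => ?_)
        (tendsto_one_div_add_atTop_nhds_zero_nat.mono_left hatTop)
      have := hp n i D (D + 1 / ((n : ℝ) + 1))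
      rw [p1] at this
      refine this.trans_eq ?_
      rw [sub_add_cancel_left, abs_neg, abs_of_pos (Nat.one_div_pos_of_nat (n := n))]
    have h2 := tendsto_nhds_unique h1 (((hfP i D).sub_const _).abs)
    exact sub_eq_zero.1 (abs_eq_zero.1 h2.symm)
  · exact le_of_tendsto (((hfP i s).sub (hfP i t)).abs) (Eventually.of_forall fun n => hp n i s t)

/-- A copy of `X`, to be endowed with the metric `intrinsicDist f`. -/
def IntrinsicSpace {X : Type} {ι : Type*} (_ : ι → X → ℝ) : Type := X

/-- A compact space carrying a separating family of continuous functions, with enough paths along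
which the family is Lipschitz, has a compatible geodesic metric for which the members of the family
are `1`-Lipschitz and the given paths are upper bounds for the distance. -/
theorem exists_geodesic_metric {X : Type} {ι : Type*} {f : ι → X → ℝ}
    [TopologicalSpace X] [CompactSpace X] [Nonempty X]
    (hf : ∀ i, Continuous (f i)) (hsep : ∀ x y, (∀ i, f i x = f i y) → x = y)
    (hconn : ∀ x y, ∃ C, Joins f C x y)
    (hloc : ∀ x, ∀ ε > 0, ∀ᶠ y in 𝓝 x, Joins f ε x y) :
    ∃ (Y : Type) (_ : MetricSpace Y) (e : X ≃ₜ Y), GameSpaceD Y (fun x y => dist x y) ∧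
      (∀ i x y, |f i x - f i y| ≤ dist (e x) (e y)) ∧
      ∀ C x y, Joins f C x y → dist (e x) (e y) ≤ C := by
  have hJ : ∀ x y, Joins f (intrinsicDist f x y) x y := fun x y =>
    joins_intrinsicDist hf hsep (hconn x y)
  let m : MetricSpace (IntrinsicSpace f) :=
    { dist := intrinsicDist f
      dist_self := fun x => le_antisymm (Joins.refl (X := X) x).intrinsicDist_le (hJ x x).1
      dist_comm := fun x y => le_antisymm (hJ y x).symm.intrinsicDist_le
        (hJ x y).symm.intrinsicDist_le
      dist_triangle := fun x y z => ((hJ x y).trans (hJ y z)).intrinsicDist_le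
      eq_of_dist_eq_zero := fun {x y} h => by
        refine hsep x y fun i => ?_
        have := (hJ x y).abs_sub_le i
        rw [show intrinsicDist f x y = 0 from h] at this
        exact sub_eq_zero.1 (abs_nonpos_iff.1 this) }
  let E : X ≃ IntrinsicSpace f := Equiv.refl X
  have hdist : ∀ x y : X, dist (E x) (E y) = intrinsicDist f x y := fun _ _ => rfl
  have hcont : Continuous E := by
    refine continuous_iff_continuousAt.2 fun x => Metric.tendsto_nhds.2 fun ε hε => ?_
    filter_upwards [hloc x (ε / 2) (half_pos hε)] with y hy
    rw [dist_comm, hdist]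
    exact hy.intrinsicDist_le.trans_lt (half_lt_self hε)
  let e : X ≃ₜ IntrinsicSpace f := hcont.homeoOfEquivCompactToT2
  have : CompactSpace (IntrinsicSpace f) := e.compactSpace
  refine ⟨IntrinsicSpace f, m, e, ⟨‹Nonempty X›.map E, ⟨dist_self,
    fun x y => eq_of_dist_eq_zero, dist_comm, dist_triangle⟩, fun u => ?_, fun x y => ?_⟩,
    fun i x y => (hJ x y).abs_sub_le i, fun C x y h => h.intrinsicDist_le⟩
  · obtain ⟨z, φ, hφ, hz⟩ := CompactSpace.tendsto_subseq u
    exact ⟨z, φ, hφ, tendsto_iff_dist_tendsto_zero.1 hz⟩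
  · obtain ⟨x, rfl⟩ := E.surjective x
    obtain ⟨y, rfl⟩ := E.surjective y
    simp only [hdist]
    set D := intrinsicDist f x y with hD
    obtain ⟨hD0, p, p0, p1, hp⟩ := hJ x y
    rw [← hD] at hD0 p1
    have hpd : ∀ s t, dist (E (p s)) (E (p t)) ≤ |s - t| := by
      have : ∀ s t, s ≤ t → dist (E (p s)) (E (p t)) ≤ t - s := fun s t hst => by
        refine Joins.intrinsicDist_le (x := p s) (y := p t)
          ⟨sub_nonneg.2 hst, fun u => p (s + u), by simp, by simp,
          fun i a b => (hp i _ _).trans_eq (by simp)⟩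
      intro s t
      rcases le_total s t with h | h
      · rw [abs_sub_comm, abs_of_nonneg (sub_nonneg.2 h)]
        exact this s t h
      · rw [dist_comm, abs_of_nonneg (sub_nonneg.2 h)]
        exact this t s h
    have hpD : ∀ s t, dist (E (p (s * D))) (E (p (t * D))) ≤ |s - t| * D := fun s t => by
      refine (hpd _ _).trans_eq ?_
      rw [← sub_mul, abs_mul, abs_of_nonneg hD0]
    refine ⟨fun t => E (p (t * D)), fun t _ ε hε => ?_, by simp [p0], by simp [p1], ?_⟩
    · have hc : Tendsto (fun t' : ℝ => ENNReal.ofReal (|t - t'| * D)) (𝓝 t) (𝓝 0) := by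
        have : Continuous fun t' : ℝ => ENNReal.ofReal (|t - t'| * D) :=
          ENNReal.continuous_ofReal.comp (by fun_prop)
        simpa using this.tendsto t
      obtain ⟨δ, hδ, h⟩ := Metric.eventually_nhds_iff.1 (hc.eventually_lt_const hε)
      exact ⟨δ, hδ, fun t' _ ht' => (ENNReal.ofReal_le_ofReal (hpD t t')).trans_lt (h ht')⟩
    · refine le_antisymm (iSup_le fun q => ?_) ?_
      · obtain ⟨n, u, hu, hmem⟩ := q
        have hsum : ∑ i ∈ Finset.range n, dist (E (p (u i * D))) (E (p (u (i + 1) * D))) ≤ D := by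
          calc ∑ i ∈ Finset.range n, dist (E (p (u i * D))) (E (p (u (i + 1) * D)))
              ≤ ∑ i ∈ Finset.range n, (u (i + 1) - u i) * D := by
                refine Finset.sum_le_sum fun i _ => (hpD _ _).trans_eq ?_
                rw [abs_sub_comm, abs_of_nonneg (sub_nonneg.2 (hu i.le_succ))]
            _ = (u n - u 0) * D := by rw [← Finset.sum_mul, Finset.sum_range_sub]
            _ ≤ 1 * D := by
                gcongr
                linarith [(hmem n).2, (hmem 0).1]
            _ = D := one_mul D
        dsimp only
        rw [← ENNReal.ofReal_sum_of_nonneg fun i _ => dist_nonneg]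
        exact ENNReal.ofReal_le_ofReal hsum
      · refine le_iSup_of_le ⟨1, fun n => if n = 0 then 0 else 1, fun a b hab => ?_, fun i => ?_⟩ ?_
        · dsimp only
          split_ifs <;> first | omega | norm_num
        · dsimp only
          split_ifs <;> simp
        · simp [p0, p1, hdist, ← hD]

end Intrinsic

section Robber

variable {Y : Type*} {d : Y → Y → ℝ} {k : ℕ}

theorem copTraj_congr (c0 : Fin k → Y) (σ : (n : ℕ) → (Fin (n + 2) → Y) → Fin k → Y)
    {r r' : ℕ → Y} {n : ℕ} (h : ∀ i ≤ n, r i = r' i) :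
    copTraj c0 σ r n = copTraj c0 σ r' n := by
  cases n with
  | zero => rfl
  | succ n =>
    simp only [copTraj]
    congr 1
    funext i
    exact h i (by omega)

/-- Against a fixed cop strategy, any rule computing the robber's move from the current positions
can be carried out. -/
theorem exists_robber_trajectory (c0 : Fin k → Y)
    (σ : (n : ℕ) → (Fin (n + 2) → Y) → Fin k → Y) (v0 : Y) (next : Y → (Fin k → Y) → Y) :
    ∃ r : ℕ → Y, r 0 = v0 ∧ ∀ n, r (n + 1) = next (r n) (copTraj c0 σ r n) := by
  let hist : ℕ → ℕ → Y := fun n => Nat.rec (fun _ => v0)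
    (fun n h => Function.update h (n + 1) (next (h n) (copTraj c0 σ h n))) n
  have hsucc : ∀ n, hist (n + 1) =
    Function.update (hist n) (n + 1) (next (hist n n) (copTraj c0 σ (hist n) n)) := fun n => rfl
  have hmem : ∀ m i, i ≤ m → hist m i = hist i i := by
    intro m
    induction m with
    | zero => intro i hi; rw [Nat.le_zero.1 hi]
    | succ m ih =>
      intro i hi
      rcases hi.eq_or_lt with rfl | hi
      · rfl
      · rw [hsucc, Function.update_of_ne hi.ne, ih i (by omega)]
  refine ⟨fun n => hist n n, rfl, fun n => ?_⟩
  dsimp only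
  rw [hsucc, Function.update_self, copTraj_congr c0 σ (hmem n)]

/-- The robber escapes from `k` cops if he can always jump to a position which no cop threatens. -/
theorem not_copsWinWith (hd : IsMetricD Y d) {s a : ℝ} (hs : 0 < s) (ha : 0 < a) (V : Set Y)
    {v0 y0 : Y} (hv0 : v0 ∈ V) (h0 : a ≤ d y0 v0)
    (H : ∀ v ∈ V, ∀ x : Fin k → Y, (∀ i, a ≤ d (x i) v) →
      ∃ w ∈ V, d v w ≤ s ∧ ∀ i, s + a ≤ d (x i) w) : ¬ CopsWinWith Y d k := by
  obtain ⟨hself, -, hsymm, htri⟩ := hd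
  intro hwin
  obtain ⟨σ, hσ⟩ := hwin (fun _ => s) ⟨fun _ => hs, fun h => hs.ne' (by
    simpa using tendsto_nhds_unique tendsto_const_nhds h.tendsto_atTop_zero)⟩ v0 fun _ => y0
  have hnext : ∀ v (x : Fin k → Y), ∃ w, d v w ≤ s ∧
      (v ∈ V → (∀ i, a ≤ d (x i) v) → w ∈ V ∧ ∀ i, s + a ≤ d (x i) w) := fun v x => by
    by_cases h : v ∈ V ∧ ∀ i, a ≤ d (x i) v
    · obtain ⟨w, hw, h1, h2⟩ := H v h.1 x h.2
      exact ⟨w, h1, fun _ _ => ⟨hw, h2⟩⟩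
    · exact ⟨v, (hself v).trans_le hs.le, fun h1 h2 => absurd ⟨h1, h2⟩ h⟩
  choose next hnext1 hnext2 using hnext
  obtain ⟨r, r0, hr⟩ := exists_robber_trajectory (fun _ => y0) σ v0 next
  obtain ⟨hlegal, hcatch⟩ := hσ r r0 fun n => hr n ▸ hnext1 _ _
  have hinv : ∀ n, r n ∈ V ∧ ∀ i, a ≤ d (copTraj (fun _ => y0) σ r n i) (r n) := by
    intro n
    induction n with
    | zero => exact r0.symm ▸ ⟨hv0, fun _ => h0⟩
    | succ n ih =>
      obtain ⟨h1, h2⟩ := hnext2 _ _ ih.1 ih.2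
      rw [← hr] at h1 h2
      refine ⟨h1, fun i => ?_⟩
      have := htri (copTraj (fun _ => y0) σ r n i) (copTraj (fun _ => y0) σ r (n + 1) i) (r (n + 1))
      linarith [h2 i, hlegal n i]
  obtain ⟨n, i, hlt⟩ := hcatch a ha
  rw [hsymm] at hlt
  exact absurd ((hinv n).2 i) (not_le.2 hlt)

theorem copNumber_eq_top (h : ∀ k : ℕ, ¬ CopsWinWith Y d k) : copNumber Y d = ⊤ := by
  rw [copNumber, sInf_eq_top]
  rintro _ ⟨k, -, hk⟩
  exact absurd hk (h k)

end Robber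

/-- A placement of a graph without triangles and squares in space: `dev v w x` measures how far
`x` is from the line through the adjacent hubs `c v` and `c w`, all edges have length `H`, and
disjoint edges and hubs are far from each other. -/
structure Layout {V : Type} (G : SimpleGraph V) where
  triangle_free : ∀ {u v w}, G.Adj u v → G.Adj v w → ¬ G.Adj u w
  square_free : ∀ {u v w z}, G.Adj v w → G.Adj v z → G.Adj u w → G.Adj u z → w ≠ z → u = v
  H : ℝ
  one_le : 1 ≤ H
  c : V → Fin 3 → ℝ
  norm_c_le : ∀ v, ‖c v‖ ≤ H
  dev : V → V → (Fin 3 → ℝ) → ℝ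
  dev_nonneg : ∀ v w x, 0 ≤ dev v w x
  dev_comm : ∀ v w x, dev v w x = dev w v x
  dev_lipschitz : ∀ {v w}, G.Adj v w → ∀ x y, dev v w x ≤ dev v w y + 2 * ‖x - y‖
  dev_self : ∀ {v w}, G.Adj v w → dev v w (c w) = 0
  dev_ray : ∀ {v w}, G.Adj v w → ∀ (t : ℝ) (ξ : Fin 3 → ℝ), 0 ≤ t →
    dev v w (c v + t • ξ) = t * dev v w (c v + ξ)
  abs_height : ∀ {v w}, G.Adj v w → |c v 0 - c w 0| = H
  norm_edge : ∀ {v w}, G.Adj v w → ‖c v - c w‖ = H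
  norm_sub_le : ∀ {v w}, G.Adj v w → ∀ x, ‖x - c v‖ ≤ |x 0 - c v 0| + dev v w x
  height_le : ∀ {v w z}, G.Adj v w → G.Adj v z → w ≠ z → ∀ x,
    |x 0 - c v 0| ≤ H * (dev v w x + dev v z x)
  dev_disjoint : ∀ {v w u z}, G.Adj v w → G.Adj u z → v ≠ u → v ≠ z → w ≠ u → w ≠ z → ∀ x,
    1 / 2 ≤ dev v w x + dev u z x
  dev_hub : ∀ {v w u}, G.Adj v w → u ≠ v → u ≠ w → 1 ≤ dev v w (c u)
  norm_hub : ∀ {u v}, u ≠ v → 1 ≤ ‖c u - c v‖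

/-- Along the segment from `x` to `y`, the family `q` is `C`-Lipschitz in the parameter. -/
def Tame {W : Type} (q : W → (Fin 3 → ℝ) → ℝ) (C : ℝ) (x y : Fin 3 → ℝ) : Prop :=
  ‖x - y‖ ≤ C ∧ ∀ w, ∀ s ∈ Icc (0 : ℝ) 1, ∀ t ∈ Icc (0 : ℝ) 1,
    |q w (x + s • (y - x)) - q w (x + t • (y - x))| ≤ C * |s - t|

namespace Layout

variable {V : Type} {G : SimpleGraph V} (K : Layout G)

/-- The part of the bump of `w` near the hub of `w`. -/
noncomputable def hub (w : V) (x : Fin 3 → ℝ) : ℝ :=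
  K.H + 1 / 4 - max ‖x - K.c w‖ (16 * K.H * ‖x - K.c w‖ - (16 * K.H - 1) / 4)

/-- The part of the bump of `w` along the edge from `u`. -/
noncomputable def beam (u w : V) (x : Fin 3 → ℝ) : ℝ :=
  K.H + 1 / 4 - |x 0 - K.c w 0| - 16 * K.H * K.dev u w x

open Classical in
/-- The bump of `w`, supported near the hub of `w` and the edges at `w`. -/
noncomputable def bump (w : V) (x : Fin 3 → ℝ) : ℝ :=
  ⨆ o : Option V, o.elim (max 0 (K.hub w x)) fun u =>
    if G.Adj u w then max 0 (max (1 / 4 - ‖x - K.c u‖) (K.beam u w x)) else 0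

variable {K}

theorem bump_le_iff [Finite V] {w : V} {x : Fin 3 → ℝ} {b : ℝ} :
    K.bump w x ≤ b ↔ 0 ≤ b ∧ K.hub w x ≤ b ∧
      ∀ u, G.Adj u w → 1 / 4 - ‖x - K.c u‖ ≤ b ∧ K.beam u w x ≤ b := by
  classical
  rw [bump, ciSup_le_iff (Set.finite_range _).bddAbove]
  constructor
  · intro h
    have h0 := h none
    simp only [Option.elim_none, max_le_iff] at h0
    refine ⟨h0.1, h0.2, fun u hu => ?_⟩
    have h1 := h (some u)
    simp only [Option.elim_some, if_pos hu, max_le_iff] at h1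
    exact h1.2
  · rintro ⟨h0, h1, h2⟩ (_ | u)
    · simpa using ⟨h0, h1⟩
    · simp only [Option.elim_some]
      split_ifs with hu
      · exact max_le h0 (max_le (h2 u hu).1 (h2 u hu).2)
      · exact h0

theorem bump_nonneg [Finite V] (w : V) (x : Fin 3 → ℝ) : 0 ≤ K.bump w x :=
  (bump_le_iff.1 le_rfl).1

theorem hub_le_bump [Finite V] (w : V) (x : Fin 3 → ℝ) : K.hub w x ≤ K.bump w x :=
  (bump_le_iff.1 le_rfl).2.1

theorem cap_le_bump [Finite V] {u w : V} (h : G.Adj u w) (x : Fin 3 → ℝ) :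
    1 / 4 - ‖x - K.c u‖ ≤ K.bump w x :=
  ((bump_le_iff.1 le_rfl).2.2 u h).1

theorem beam_le_bump [Finite V] {u w : V} (h : G.Adj u w) (x : Fin 3 → ℝ) :
    K.beam u w x ≤ K.bump w x :=
  ((bump_le_iff.1 le_rfl).2.2 u h).2

theorem norm_lt_of_hub_pos {w : V} {x : Fin 3 → ℝ} (h : 0 < K.hub w x) :
    ‖x - K.c w‖ < 5 / 16 := by
  have h1 := K.one_le
  have := le_max_right ‖x - K.c w‖ (16 * K.H * ‖x - K.c w‖ - (16 * K.H - 1) / 4)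
  rw [hub] at h
  by_contra! h2
  nlinarith

theorem dev_lt_of_beam_pos {u w : V} {x : Fin 3 → ℝ} (h : 0 < K.beam u w x) :
    K.dev u w x < 1 / 8 := by
  have h1 := K.one_le
  have := abs_nonneg (x 0 - K.c w 0)
  rw [beam] at h
  by_contra! h2
  nlinarith

theorem pos_cases [Finite V] {w : V} {x : Fin 3 → ℝ} (h : 0 < K.bump w x) :
    ‖x - K.c w‖ < 5 / 16 ∨ ∃ u, G.Adj u w ∧ (‖x - K.c u‖ < 1 / 4 ∨ 0 < K.beam u w x) := by
  by_contra! h2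
  refine absurd (bump_le_iff.2 ⟨le_rfl, ?_, fun u hu => ⟨?_, (h2.2 u hu).2⟩⟩) (not_le.2 h)
  · by_contra! h3
    exact absurd (norm_lt_of_hub_pos h3) (not_lt.2 h2.1)
  · linarith [(h2.2 u hu).1]

theorem hub_ne {u v : V} {x : Fin 3 → ℝ} (h : ‖x - K.c u‖ + ‖x - K.c v‖ < 1) :
    u = v := by
  by_contra hne
  have h1 := K.norm_hub hne
  have h2 := norm_sub_le_norm_sub_add_norm_sub (K.c u) x (K.c v)
  rw [norm_sub_rev (K.c u) x] at h2
  linarith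

theorem mem_edge {u v w : V} {x : Fin 3 → ℝ} (hvw : G.Adj v w)
    (h : K.dev v w x + 2 * ‖x - K.c u‖ < 1) : u = v ∨ u = w := by
  by_contra! hne
  have h1 := K.dev_hub hvw hne.1 hne.2
  have h2 := K.dev_lipschitz hvw (K.c u) x
  rw [norm_sub_rev] at h2
  linarith

theorem height_sub_le {v w : V} (h : G.Adj v w) (x : Fin 3 → ℝ) :
    K.H - |x 0 - K.c v 0| ≤ |x 0 - K.c w 0| := by
  have h1 := K.abs_height h
  have h2 := abs_sub_le (K.c v 0) (x 0) (K.c w 0)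
  rw [abs_sub_comm _ (x 0)] at h2
  linarith

theorem norm_lt_of_bump_pos [Finite V] {v w z : V} {x : Fin 3 → ℝ} (hw : G.Adj v w)
    (hz : G.Adj v z) (hwz : w ≠ z) (hqw : 0 < K.bump w x) (hqz : 0 < K.bump z x) :
    ‖x - K.c v‖ < 1 / 4 := by
  have nwz : ¬ G.Adj w z := K.triangle_free hw.symm hz
  have common : ∀ {u}, G.Adj u w → G.Adj u z → u = v := fun h1 h2 =>
    K.square_free hw hz h1 h2 hwz
  rcases pos_cases hqw with h1 | ⟨u, hu, h1 | h1⟩ <;>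
    rcases pos_cases hqz with h2 | ⟨u', hu', h2 | h2⟩
  · exact absurd (hub_ne (x := x) (by linarith)) hwz
  · have := hub_ne (K := K) (u := w) (v := u') (x := x) (by linarith)
    exact absurd (this ▸ hu') nwz
  · have := dev_lt_of_beam_pos h2
    rcases mem_edge (u := w) hu' (by linarith) with h | h
    · exact absurd (h ▸ hu') nwz
    · exact absurd h hwz
  · have := hub_ne (K := K) (u := u) (v := z) (x := x) (by linarith)
    exact absurd (this ▸ hu).symm nwz
  · have := hub_ne (K := K) (u := u) (v := u') (x := x) (by linarith)
    subst this
    rwa [← common hu hu']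
  · have := dev_lt_of_beam_pos h2
    rcases mem_edge (u := u) hu' (by linarith) with h | h
    · subst h
      rwa [← common hu hu']
    · exact absurd (h ▸ hu).symm nwz
  · have := dev_lt_of_beam_pos h1
    rcases mem_edge (u := z) hu (by linarith) with h | h
    · exact absurd (h ▸ hu).symm nwz
    · exact absurd h.symm hwz
  · have := dev_lt_of_beam_pos h1
    rcases mem_edge (u := u') hu (by linarith) with h | h
    · subst h
      rwa [← common hu hu']
    · exact absurd (h ▸ hu') nwz
  · have h3 := dev_lt_of_beam_pos h1
    have h4 := dev_lt_of_beam_pos h2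
    by_cases huu : u = u'
    · subst huu
      obtain rfl := common hu hu'
      have h5 := height_sub_le (K := K) hw x
      have h6 := height_sub_le (K := K) hz x
      have h7 := K.height_le hw hz hwz x
      have h8 := K.norm_sub_le hw x
      have h9 := K.one_le
      rw [beam] at h1 h2
      have h10 : K.dev u w x ≤ K.H * K.dev u w x :=
        le_mul_of_one_le_left (K.dev_nonneg _ _ _) h9
      linarith
    · have := K.dev_disjoint hu hu' huu (fun h => nwz (h ▸ hu).symm)
        (fun h => nwz (h ▸ hu')) hwz x
      linarith

theorem bump_eq_zero_of_far [Finite V] {w : V} {x : Fin 3 → ℝ} (h : 2 * K.H + 2 ≤ ‖x‖) :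
    K.bump w x = 0 := by
  refine le_antisymm (not_lt.1 fun hpos => ?_) (bump_nonneg w x)
  have h1 := K.one_le
  have far : ∀ v, K.H + 2 ≤ ‖x - K.c v‖ := fun v => by
    linarith [norm_sub_norm_le x (K.c v), K.norm_c_le v]
  rcases pos_cases hpos with h2 | ⟨u, hu, h2 | h2⟩
  · linarith [far w]
  · linarith [far u]
  · have h3 := dev_lt_of_beam_pos h2
    have h4 := K.norm_sub_le hu.symm x
    rw [K.dev_comm] at h4
    have h5 := far w
    rw [beam] at h2
    nlinarith [K.dev_nonneg u w x]

theorem bump_lipschitz [Finite V] (w : V) (x y : Fin 3 → ℝ) :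
    |K.bump w x - K.bump w y| ≤ (1 + 32 * K.H) * ‖x - y‖ := by
  have h1 := K.one_le
  have key : ∀ x y, K.bump w x ≤ K.bump w y + (1 + 32 * K.H) * ‖x - y‖ := fun x y => by
    have h0 : 0 ≤ ‖x - y‖ := norm_nonneg _
    have hn : ∀ v, ‖y - K.c v‖ ≤ ‖x - K.c v‖ + ‖x - y‖ := fun v => by
      have := norm_sub_le_norm_sub_add_norm_sub y x (K.c v)
      rw [norm_sub_rev y x] at this
      linarith
    have hH : ‖x - y‖ ≤ K.H * ‖x - y‖ := le_mul_of_one_le_left h0 h1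
    refine bump_le_iff.2 ⟨by nlinarith [bump_nonneg (K := K) w y], ?_, fun u hu => ⟨?_, ?_⟩⟩
    · refine le_trans ?_ (add_le_add_left (hub_le_bump w y) _)
      rw [hub, hub]
      have : max ‖y - K.c w‖ (16 * K.H * ‖y - K.c w‖ - (16 * K.H - 1) / 4) ≤
          max ‖x - K.c w‖ (16 * K.H * ‖x - K.c w‖ - (16 * K.H - 1) / 4)
            + 16 * K.H * ‖x - y‖ := by
        refine max_le ?_ ?_
        · linarith [le_max_left ‖x - K.c w‖ (16 * K.H * ‖x - K.c w‖ - (16 * K.H - 1) / 4), hn w]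
        · have := le_max_right ‖x - K.c w‖ (16 * K.H * ‖x - K.c w‖ - (16 * K.H - 1) / 4)
          nlinarith [hn w]
      linarith
    · have := cap_le_bump (K := K) hu y
      linarith [hn u]
    · refine le_trans ?_ (add_le_add_left (beam_le_bump hu y) _)
      have h2 := K.dev_lipschitz hu y x
      rw [norm_sub_rev] at h2
      have h3 := abs_sub_le (y 0) (x 0) (K.c w 0)
      have h4 : |y 0 - x 0| ≤ ‖x - y‖ := by
        rw [norm_sub_rev]
        exact norm_le_pi_norm (y - x) 0
      rw [beam, beam]
      nlinarith
  rw [abs_sub_le_iff]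
  refine ⟨by linarith [key x y], ?_⟩
  have := key y x
  rw [norm_sub_rev] at this
  linarith

theorem bump_le_sub_norm [Finite V] {w : V} {x : Fin 3 → ℝ} (h : ‖x - K.c w‖ ≤ K.H) :
    K.bump w x ≤ K.H + 1 / 4 - ‖x - K.c w‖ := by
  have h1 := K.one_le
  refine bump_le_iff.2 ⟨by linarith, ?_, fun u hu => ⟨?_, ?_⟩⟩
  · rw [hub]
    linarith [le_max_left ‖x - K.c w‖ (16 * K.H * ‖x - K.c w‖ - (16 * K.H - 1) / 4)]
  · linarith [norm_nonneg (x - K.c u)]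
  · have h2 := K.norm_sub_le hu.symm x
    have h3 : K.dev u w x ≤ K.H * K.dev u w x :=
      le_mul_of_one_le_left (K.dev_nonneg _ _ _) h1
    rw [beam]
    rw [K.dev_comm] at h2
    linarith [K.dev_nonneg u w x]

theorem bump_near_self [Finite V] {w : V} {x : Fin 3 → ℝ} (h : ‖x - K.c w‖ ≤ 1 / 4) :
    K.bump w x = K.H + 1 / 4 - ‖x - K.c w‖ := by
  have h1 := K.one_le
  refine le_antisymm (bump_le_sub_norm (by linarith)) (le_trans ?_ (hub_le_bump w x))
  rw [hub, max_eq_left]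
  nlinarith

theorem bump_self [Finite V] (w : V) : K.bump w (K.c w) = K.H + 1 / 4 := by
  rw [bump_near_self (by simp)]
  simp

theorem bump_near_adj [Finite V] {v w : V} (hvw : G.Adj v w) {x : Fin 3 → ℝ}
    (h : ‖x - K.c v‖ ≤ 1 / 4) :
    K.bump w x = max (1 / 4 - ‖x - K.c v‖) (K.beam v w x) := by
  refine le_antisymm (bump_le_iff.2 ⟨?_, ?_, fun u hu => ?_⟩)
    (max_le (cap_le_bump hvw x) (beam_le_bump hvw x))
  · exact le_max_of_le_left (sub_nonneg.2 h)
  · refine le_max_of_le_left (le_trans (not_lt.1 fun hp => ?_) (sub_nonneg.2 h))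
    exact hvw.ne (hub_ne (K := K) (x := x) (by linarith [norm_lt_of_hub_pos hp]))
  · by_cases huv : u = v
    · subst huv
      exact ⟨le_max_left _ _, le_max_right _ _⟩
    · constructor <;> refine le_max_of_le_left (le_trans (not_lt.1 fun hp => ?_) (sub_nonneg.2 h))
      · exact huv (hub_ne (K := K) (x := x) (by linarith))
      · rcases mem_edge (K := K) (u := v) (x := x) hu (by linarith [dev_lt_of_beam_pos hp])
          with h' | h'
        · exact huv h'.symm
        · exact hvw.ne h'

theorem bump_near_other [Finite V] {v w : V} (hvw : ¬ G.Adj v w) (hne : v ≠ w)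
    {x : Fin 3 → ℝ} (h : ‖x - K.c v‖ ≤ 1 / 4) : K.bump w x = 0 := by
  refine le_antisymm (not_lt.1 fun hpos => ?_) (bump_nonneg w x)
  rcases pos_cases hpos with h2 | ⟨u, hu, h2 | h2⟩
  · exact hne (hub_ne (K := K) (x := x) (by linarith))
  · have := hub_ne (K := K) (u := v) (v := u) (x := x) (by linarith)
    exact hvw (this ▸ hu)
  · rcases mem_edge (K := K) (u := v) (x := x) hu (by linarith [dev_lt_of_beam_pos h2])
      with h' | h'
    · exact hvw (h' ▸ hu)
    · exact hne h'

theorem abs_sub_le_of_affine {g : ℝ → ℝ} {A M C : ℝ} (hM : |M| ≤ C)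
    (hg : ∀ t ∈ Icc (0 : ℝ) 1, g t = A + t * M) :
    ∀ s ∈ Icc (0 : ℝ) 1, ∀ t ∈ Icc (0 : ℝ) 1, |g s - g t| ≤ C * |s - t| := by
  intro s hs t ht
  rw [hg s hs, hg t ht, add_sub_add_left_eq_sub, ← sub_mul, abs_mul, mul_comm]
  gcongr

theorem tame_radial [Finite V] {v : V} {x : Fin 3 → ℝ} (h : ‖x - K.c v‖ ≤ 1 / 4) :
    Tame K.bump ‖x - K.c v‖ (K.c v) x := by
  refine ⟨(norm_sub_rev _ _).le, fun w => ?_⟩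
  obtain ⟨ξ, rfl⟩ : ∃ ξ, x = K.c v + ξ := ⟨x - K.c v, by simp⟩
  rw [add_sub_cancel_left] at h ⊢
  have h1 := K.one_le
  have hn : ∀ t ∈ Icc (0 : ℝ) 1, ‖K.c v + t • ξ - K.c v‖ = t * ‖ξ‖ := fun t ht => by
    rw [add_sub_cancel_left, norm_smul, Real.norm_of_nonneg ht.1]
  have hn' : ∀ t ∈ Icc (0 : ℝ) 1, ‖K.c v + t • ξ - K.c v‖ ≤ 1 / 4 := fun t ht => by
    rw [hn t ht]
    nlinarith [norm_nonneg ξ, ht.1, ht.2]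
  by_cases hvw : v = w
  · subst hvw
    refine abs_sub_le_of_affine (A := K.H + 1 / 4) (M := -‖ξ‖) (by simp) fun t ht => ?_
    rw [bump_near_self (hn' t ht), hn t ht]
    ring
  by_cases hadj : G.Adj v w
  · have hξ0 : |ξ 0| ≤ ‖ξ‖ := norm_le_pi_norm ξ 0
    obtain ⟨τ, hτ, hheight⟩ : ∃ τ, |τ| ≤ ‖ξ‖ ∧ ∀ t ∈ Icc (0 : ℝ) 1,
        |(K.c v + t • ξ) 0 - K.c w 0| = K.H - t * τ := by
      have hb : ∀ t ∈ Icc (0 : ℝ) 1, |t * ξ 0| ≤ K.H := fun t ht => by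
        rw [abs_mul, abs_of_nonneg ht.1]
        nlinarith [abs_nonneg (ξ 0), ht.1, ht.2]
      rcases eq_or_eq_neg_of_abs_eq (K.abs_height hadj) with hH | hH
      · refine ⟨-ξ 0, by rwa [abs_neg], fun t ht => ?_⟩
        have := abs_le.1 (hb t ht)
        rw [Pi.add_apply, Pi.smul_apply, smul_eq_mul, add_sub_right_comm, hH, abs_of_nonneg]
        · ring
        · linarith
      · refine ⟨ξ 0, hξ0, fun t ht => ?_⟩
        have := abs_le.1 (hb t ht)
        rw [Pi.add_apply, Pi.smul_apply, smul_eq_mul, add_sub_right_comm, hH, abs_of_nonpos]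
        · ring
        · linarith
    have hD := K.dev_nonneg v w (K.c v + ξ)
    refine abs_sub_le_of_affine (A := 1 / 4)
      (M := max (-‖ξ‖) (τ - 16 * K.H * K.dev v w (K.c v + ξ))) ?_ fun t ht => ?_
    · refine abs_le.2 ⟨le_max_left _ _, max_le (by linarith [norm_nonneg ξ]) ?_⟩
      nlinarith [(abs_le.1 hτ).2]
    · rw [bump_near_adj hadj (hn' t ht), hn t ht, beam, hheight t ht, K.dev_ray hadj t ξ ht.1,
        mul_max_of_nonneg _ _ ht.1, ← max_add_add_left]
      congr 1 <;> ring
  · refine abs_sub_le_of_affine (A := 0) (M := 0) (by simp) fun t ht => ?_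
    simpa using bump_near_other hadj hvw (hn' t ht)

section Edge

variable {v z w : V} {t : ℝ}

theorem dev_edge (hvz : G.Adj v z) (ht : t ∈ Icc (0 : ℝ) 1) :
    K.dev v z (K.c v + t • (K.c z - K.c v)) = 0 := by
  rw [K.dev_ray hvz t _ ht.1, add_sub_cancel, K.dev_self hvz, mul_zero]

theorem edge_rev (x y : Fin 3 → ℝ) (t : ℝ) : x + t • (y - x) = y + (1 - t) • (x - y) := by
  module

theorem norm_edge_sub (hvz : G.Adj v z) (ht : t ∈ Icc (0 : ℝ) 1) :
    ‖K.c v + t • (K.c z - K.c v) - K.c v‖ = t * K.H := by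
  rw [add_sub_cancel_left, norm_smul, Real.norm_of_nonneg ht.1, norm_sub_rev, K.norm_edge hvz]

theorem abs_edge_height (hvz : G.Adj v z) (ht : t ∈ Icc (0 : ℝ) 1) :
    |(K.c v + t • (K.c z - K.c v)) 0 - K.c v 0| = t * K.H := by
  rw [Pi.add_apply, add_sub_cancel_left, Pi.smul_apply, smul_eq_mul, abs_mul, abs_of_nonneg ht.1,
    Pi.sub_apply, abs_sub_comm, K.abs_height hvz]

theorem bump_edge_end [Finite V] (hvz : G.Adj v z) (ht : t ∈ Icc (0 : ℝ) 1) :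
    K.bump z (K.c v + t • (K.c z - K.c v)) = 1 / 4 + t * K.H := by
  have ht' : 1 - t ∈ Icc (0 : ℝ) 1 := ⟨by linarith [ht.2], by linarith [ht.1]⟩
  have h1 := K.one_le
  apply le_antisymm
  · have hn := norm_edge_sub (K := K) hvz.symm ht'
    rw [← edge_rev] at hn
    refine (bump_le_sub_norm ?_).trans_eq ?_
    · rw [hn]
      nlinarith [ht.1]
    · rw [hn]
      ring
  · refine le_trans ?_ (beam_le_bump hvz _)
    have hh := abs_edge_height (K := K) hvz.symm ht'
    rw [← edge_rev] at hh
    rw [beam, dev_edge hvz ht, hh]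
    linarith

theorem bump_edge_adj [Finite V] (hvz : G.Adj v z) (hvw : G.Adj v w) (hwz : w ≠ z)
    (ht : t ∈ Icc (0 : ℝ) 1) :
    K.bump w (K.c v + t • (K.c z - K.c v)) = max 0 (1 / 4 - t * K.H) := by
  have hd := dev_edge (K := K) hvz ht
  have hn := norm_edge_sub (K := K) hvz ht
  have hh := abs_edge_height (K := K) hvz ht
  generalize K.c v + t • (K.c z - K.c v) = x at *
  have h1 := K.one_le
  have nwz : ¬ G.Adj w z := K.triangle_free hvw.symm hvz
  apply le_antisymm
  · refine bump_le_iff.2 ⟨le_max_left _ _, ?_, fun u hu => ?_⟩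
    · refine le_max_of_le_left (not_lt.1 fun hp => ?_)
      rcases mem_edge (K := K) (u := w) hvz (by linarith [norm_lt_of_hub_pos hp]) with h | h
      · exact hvw.ne h.symm
      · exact hwz h
    · by_cases huv : u = v
      · subst huv
        refine ⟨le_max_of_le_right (by rw [hn]), le_max_of_le_right ?_⟩
        have h2 := K.height_le hvw hvz hwz x
        have h3 := height_sub_le (K := K) hvw x
        have h4 := K.dev_nonneg u w x
        rw [hh] at h2 h3
        rw [hd, add_zero] at h2
        rw [beam]
        nlinarith
      · have huz : u ≠ z := fun h => nwz (h ▸ hu).symm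
        constructor <;> refine le_max_of_le_left (not_lt.1 fun hp => ?_)
        · rcases mem_edge (K := K) (u := u) hvz (by linarith) with h | h
          exacts [huv h, huz h]
        · have := K.dev_disjoint hvz hu (Ne.symm huv) hvw.ne huz.symm hwz.symm x
          linarith [dev_lt_of_beam_pos hp]
  · refine max_le (bump_nonneg _ _) ?_
    rw [← hn]
    exact cap_le_bump hvw x

theorem bump_edge_other [Finite V] (hvz : G.Adj v z) (hvw : ¬ G.Adj v w) (hzw : ¬ G.Adj z w)
    (hwv : w ≠ v) (hwz : w ≠ z) (ht : t ∈ Icc (0 : ℝ) 1) :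
    K.bump w (K.c v + t • (K.c z - K.c v)) = 0 := by
  have hd := dev_edge (K := K) hvz ht
  generalize K.c v + t • (K.c z - K.c v) = x at *
  refine le_antisymm (not_lt.1 fun hpos => ?_) (bump_nonneg w x)
  rcases pos_cases hpos with h2 | ⟨u, hu, h2⟩
  · rcases mem_edge (K := K) (u := w) hvz (by linarith) with h | h
    exacts [hwv h, hwz h]
  have huv : u ≠ v := fun h => hvw (h ▸ hu)
  have huz : u ≠ z := fun h => hzw (h ▸ hu)
  rcases h2 with h2 | h2
  · rcases mem_edge (K := K) (u := u) hvz (by linarith) with h | h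
    exacts [huv h, huz h]
  · have := K.dev_disjoint hvz hu huv.symm hwv.symm huz.symm hwz.symm x
    linarith [dev_lt_of_beam_pos h2]

theorem tame_edge [Finite V] (hvz : G.Adj v z) : Tame K.bump K.H (K.c v) (K.c z) := by
  have h1 := K.one_le
  have hH : |K.H| ≤ K.H := (abs_of_nonneg (by linarith)).le
  refine ⟨(K.norm_edge hvz).le, fun w => ?_⟩
  by_cases hwz : w = z
  · subst hwz
    exact abs_sub_le_of_affine hH fun t ht => bump_edge_end hvz ht
  by_cases hwv : w = v
  · subst hwv
    refine abs_sub_le_of_affine (A := 1 / 4 + K.H) (M := -K.H) (by rwa [abs_neg]) fun t ht => ?_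
    rw [edge_rev, bump_edge_end hvz.symm ⟨by linarith [ht.2], by linarith [ht.1]⟩]
    ring
  by_cases hvw : G.Adj v w
  · intro s hs t ht
    rw [bump_edge_adj hvz hvw hwz hs, bump_edge_adj hvz hvw hwz ht]
    refine (abs_max_sub_max_le_max _ _ _ _).trans ?_
    rw [sub_self, abs_zero, max_eq_right (abs_nonneg _), sub_sub_sub_cancel_left, ← sub_mul,
      abs_mul, abs_sub_comm, mul_comm]
    gcongr
  by_cases hzw : G.Adj z w
  · intro s hs t ht
    rw [edge_rev, edge_rev _ _ t,
      bump_edge_adj hvz.symm hzw hwv ⟨by linarith [hs.2], by linarith [hs.1]⟩,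
      bump_edge_adj hvz.symm hzw hwv ⟨by linarith [ht.2], by linarith [ht.1]⟩]
    refine (abs_max_sub_max_le_max _ _ _ _).trans ?_
    rw [sub_self, abs_zero, max_eq_right (abs_nonneg _), sub_sub_sub_cancel_left, ← sub_mul,
      abs_mul, sub_sub_sub_cancel_left, mul_comm]
    gcongr
  · refine abs_sub_le_of_affine (A := 0) (M := 0) (by simpa using by linarith) fun t ht => ?_
    simpa using bump_edge_other hvz hvw hzw hwv hwz ht

end Edge

end Layout

section Concrete

theorem norm_fin_three_le {x : Fin 3 → ℝ} {r : ℝ} (hr : 0 ≤ r) :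
    ‖x‖ ≤ r ↔ |x 0| ≤ r ∧ |x 1| ≤ r ∧ |x 2| ≤ r := by
  simp [pi_norm_le_iff_of_nonneg hr, Fin.forall_fin_succ]

theorem one_le_mul_of_abs_sub_mul {a y y' x d d' : ℝ} (hy : 1 ≤ |y - y'|)
    (h : |x - a * y| ≤ d) (h' : |x - a * y'| ≤ d') : |a| ≤ d + d' := by
  calc |a| ≤ |a| * |y - y'| := le_mul_of_one_le_right (abs_nonneg a) hy
    _ = |(x - a * y') - (x - a * y)| := by rw [← abs_mul]; congr 1; ring
    _ ≤ |x - a * y'| + |x - a * y| := abs_sub _ _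
    _ ≤ d + d' := by linarith

variable {M : Type} (idx : M → ℝ) (H : ℝ)

/-- The hubs of a bipartite graph lie on two skew lines. -/
noncomputable def skewHub (v : Bool × M) : Fin 3 → ℝ :=
  if v.1 then ![H, 0, idx v.2] else ![0, idx v.2, 0]

/-- The distance, within the plane `x 0 = const`, from the line through two hubs. -/
noncomputable def skewDev (v w : Bool × M) (x : Fin 3 → ℝ) : ℝ :=
  max |x 1 - (1 - x 0 / H) * (skewHub idx H v 1 + skewHub idx H w 1)|
    |x 2 - x 0 / H * (skewHub idx H v 2 + skewHub idx H w 2)|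

variable {idx H}

theorem skewHub_add {v w : Bool × M} (h : v.1 ≠ w.1) :
    ∃ m n, skewHub idx H v 1 + skewHub idx H w 1 = idx m ∧
      skewHub idx H v 2 + skewHub idx H w 2 = idx n ∧
      (v = (false, m) ∧ w = (true, n) ∨ v = (true, n) ∧ w = (false, m)) := by
  rcases v with ⟨_ | _, m⟩ <;> rcases w with ⟨_ | _, n⟩
  · exact absurd rfl h
  · exact ⟨m, n, by simp [skewHub], by simp [skewHub], Or.inl ⟨rfl, rfl⟩⟩
  · exact ⟨n, m, by simp [skewHub], by simp [skewHub], Or.inr ⟨rfl, rfl⟩⟩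
  · exact absurd rfl h

theorem abs_skewDev_fst {v w : Bool × M} (x : Fin 3 → ℝ) {m : M}
    (h : skewHub idx H v 1 + skewHub idx H w 1 = idx m) :
    |x 1 - (1 - x 0 / H) * idx m| ≤ skewDev idx H v w x :=
  h ▸ le_max_left _ _

theorem abs_skewDev_snd {v w : Bool × M} (x : Fin 3 → ℝ) {n : M}
    (h : skewHub idx H v 2 + skewHub idx H w 2 = idx n) :
    |x 2 - x 0 / H * idx n| ≤ skewDev idx H v w x :=
  h ▸ le_max_right _ _

/-- The layout of a bipartite graph without squares on two skew lines. -/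
noncomputable def skewLayout (h1 : 1 ≤ H) (h0 : ∀ m, 0 ≤ idx m) (hH : ∀ m, idx m ≤ H)
    (hsep : ∀ m n, m ≠ n → 1 ≤ |idx m - idx n|) (G : SimpleGraph (Bool × M))
    (hG : ∀ {v w}, G.Adj v w → v.1 ≠ w.1)
    (hsq : ∀ {u v w z}, G.Adj v w → G.Adj v z → G.Adj u w → G.Adj u z → w ≠ z → u = v) :
    Layout G where
  triangle_free h h' h'' := by
    have e := hG h
    have e' := hG h'
    have e'' := hG h''
    revert e e' e''
    generalize Prod.fst _ = a, Prod.fst _ = b, Prod.fst _ = c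
    revert a b c
    decide
  square_free := hsq
  H := H
  one_le := h1
  c := skewHub idx H
  norm_c_le v := by
    have := h0 v.2
    have := hH v.2
    rw [norm_fin_three_le (by linarith)]
    rcases v with ⟨_ | _, m⟩ <;> simp [skewHub, abs_le] <;> grind
  dev := skewDev idx H
  dev_nonneg v w x := le_max_of_le_left (abs_nonneg _)
  dev_comm v w x := by
    rw [skewDev, skewDev, add_comm, add_comm (skewHub idx H v 2)]
  dev_lipschitz {v w} h x y := by
    have hn := (norm_fin_three_le (norm_nonneg (x - y))).1 le_rfl
    have hY : |skewHub idx H v 1 + skewHub idx H w 1| ≤ H := by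
      have := hG h
      rcases v with ⟨_ | _, m⟩ <;> rcases w with ⟨_ | _, n⟩ <;>
        simp [skewHub, abs_le] at this ⊢ <;> grind
    have hZ : |skewHub idx H v 2 + skewHub idx H w 2| ≤ H := by
      have := hG h
      rcases v with ⟨_ | _, m⟩ <;> rcases w with ⟨_ | _, n⟩ <;>
        simp [skewHub, abs_le] at this ⊢ <;> grind
    have key : ∀ Y, |Y| ≤ H → |(x 0 - y 0) / H * Y| ≤ ‖x - y‖ := fun Y hY => by
      rw [abs_mul, abs_div, abs_of_pos (by linarith : 0 < H), div_mul_eq_mul_div,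
        div_le_iff₀ (by linarith)]
      exact mul_le_mul hn.1 hY (abs_nonneg _) (norm_nonneg _)
    refine max_le ?_ ?_
    · refine le_trans ?_ (add_le_add_left (le_max_left _ _) _)
      generalize skewHub idx H v 1 + skewHub idx H w 1 = Y at *
      have h2 := abs_add_three (y 1 - (1 - y 0 / H) * Y) (x 1 - y 1) ((x 0 - y 0) / H * Y)
      have h3 := key Y hY
      have h4 : |x 1 - y 1| ≤ ‖x - y‖ := hn.2.1
      refine le_trans (le_of_eq ?_) (h2.trans (by linarith))
      congr 1
      ring
    · refine le_trans ?_ (add_le_add_left (le_max_right _ _) _)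
      generalize skewHub idx H v 2 + skewHub idx H w 2 = Y at *
      have h2 := abs_add_three (y 2 - y 0 / H * Y) (x 2 - y 2) (-((x 0 - y 0) / H * Y))
      have h3 := key Y hZ
      have h4 : |x 2 - y 2| ≤ ‖x - y‖ := hn.2.2
      rw [abs_neg] at h2
      refine le_trans (le_of_eq ?_) (h2.trans (by linarith))
      congr 1
      ring
  dev_self {v w} h := by
    have hne : H ≠ 0 := by linarith
    have := hG h
    rcases v with ⟨_ | _, m⟩ <;> rcases w with ⟨_ | _, n⟩ <;> simp [skewHub, skewDev, hne] at this ⊢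
  dev_ray {v w} h t ξ ht := by
    have hne : H ≠ 0 := by linarith
    have hmul : ∀ {a b}, a = t * b → |a| = t * |b| := fun h => by
      rw [h, abs_mul, abs_of_nonneg ht]
    rw [skewDev, skewDev, mul_max_of_nonneg _ _ ht]
    have := hG h
    congr 1 <;> apply hmul <;> rcases v with ⟨_ | _, m⟩ <;> rcases w with ⟨_ | _, n⟩ <;>
      simp [skewHub, add_div, hne] at this ⊢ <;> ring
  abs_height {v w} h := by
    have := hG h
    rcases v with ⟨_ | _, m⟩ <;> rcases w with ⟨_ | _, n⟩ <;> simp [skewHub] at this ⊢ <;> linarith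
  norm_edge {v w} h := by
    have h2 := hG h
    have hle : ∀ x : Fin 3 → ℝ, |x 0| = H → |x 1| ≤ H → |x 2| ≤ H → ‖x‖ = H := fun x a b c =>
      le_antisymm ((norm_fin_three_le (by linarith)).2 ⟨a.le, b, c⟩)
        (a ▸ norm_le_pi_norm x 0)
    have := h0 v.2
    have := hH v.2
    have := h0 w.2
    have := hH w.2
    rcases v with ⟨_ | _, m⟩ <;> rcases w with ⟨_ | _, n⟩ <;> simp at h2 <;>
      apply hle <;> simp [skewHub, abs_le] <;> grind
  norm_sub_le {v w} h x := by
    have hpos : 0 < H := by linarith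
    have hx : ∀ y m, |y / H * idx m| ≤ |y| := fun y m => by
      rw [abs_mul, abs_div, abs_of_pos hpos, abs_of_nonneg (h0 m), div_mul_eq_mul_div,
        div_le_iff₀ hpos]
      exact mul_le_mul_of_nonneg_left (hH m) (abs_nonneg y)
    obtain ⟨m, n, hm, hn, hvw⟩ := skewHub_add (idx := idx) (H := H) (hG h)
    have d1 := abs_skewDev_fst x hm
    have d2 := abs_skewDev_snd x hn
    have d0 := (abs_nonneg _).trans d1
    rw [norm_fin_three_le (by positivity)]
    refine ⟨by simpa using d0, ?_⟩
    rcases hvw with ⟨rfl, rfl⟩ | ⟨rfl, rfl⟩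
    · have e1 := hx (x 0) m
      have e2 := hx (x 0) n
      simp [skewHub] at d1 d2 ⊢
      rw [abs_le] at d1 d2 e1 e2
      constructor <;> rw [abs_le] <;> constructor <;> linarith
    · have e1 := hx (x 0 - H) m
      have e2 := hx (x 0 - H) n
      rw [sub_div, div_self hpos.ne'] at e1 e2
      simp [skewHub] at d1 d2 ⊢
      rw [abs_le] at d1 d2 e1 e2
      constructor <;> rw [abs_le] <;> constructor <;> linarith
  height_le {v w z} h h' hwz x := by
    have hpos : 0 < H := by linarith
    obtain ⟨m, n, hm, hn, hvw⟩ := skewHub_add (idx := idx) (H := H) (hG h)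
    obtain ⟨m', n', hm', hn', hvz⟩ := skewHub_add (idx := idx) (H := H) (hG h')
    rcases hvw with ⟨rfl, rfl⟩ | ⟨rfl, rfl⟩
    · have hne : n ≠ n' := by
        rintro rfl
        simp_all
      have := one_le_mul_of_abs_sub_mul (hsep _ _ hne) (abs_skewDev_snd x hn)
        (abs_skewDev_snd x hn')
      rw [abs_div, abs_of_pos hpos, div_le_iff₀' hpos] at this
      simpa [skewHub] using this
    · have hne : m ≠ m' := by
        rintro rfl
        simp_all
      have := one_le_mul_of_abs_sub_mul (hsep _ _ hne) (abs_skewDev_fst x hm)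
        (abs_skewDev_fst x hm')
      rw [one_sub_div hpos.ne', abs_div, abs_of_pos hpos, div_le_iff₀' hpos, abs_sub_comm] at this
      simpa [skewHub] using this
  dev_disjoint {v w u z} h h' h2 h3 h4 h5 x := by
    obtain ⟨m, n, hm, hn, hvw⟩ := skewHub_add (idx := idx) (H := H) (hG h)
    obtain ⟨m', n', hm', hn', huz⟩ := skewHub_add (idx := idx) (H := H) (hG h')
    have hne : m ≠ m' := by
      rintro rfl
      rcases hvw with ⟨rfl, rfl⟩ | ⟨rfl, rfl⟩ <;> rcases huz with ⟨rfl, rfl⟩ | ⟨rfl, rfl⟩ <;>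
        contradiction
    have hne' : n ≠ n' := by
      rintro rfl
      rcases hvw with ⟨rfl, rfl⟩ | ⟨rfl, rfl⟩ <;> rcases huz with ⟨rfl, rfl⟩ | ⟨rfl, rfl⟩ <;>
        contradiction
    have h6 := one_le_mul_of_abs_sub_mul (hsep _ _ hne) (abs_skewDev_fst x hm)
      (abs_skewDev_fst x hm')
    have h7 := one_le_mul_of_abs_sub_mul (hsep _ _ hne') (abs_skewDev_snd x hn)
      (abs_skewDev_snd x hn')
    linarith [le_abs_self (1 - x 0 / H), le_abs_self (x 0 / H)]
  dev_hub {v w u} h h2 h3 := by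
    have hne : H ≠ 0 := by linarith
    obtain ⟨m, n, hm, hn, hvw⟩ := skewHub_add (idx := idx) (H := H) (hG h)
    rcases u with ⟨_ | _, l⟩
    · have hl : l ≠ m := by
        rintro rfl
        rcases hvw with ⟨rfl, rfl⟩ | ⟨rfl, rfl⟩ <;> contradiction
      refine (hsep _ _ hl).trans ?_
      simpa [skewHub] using abs_skewDev_fst (skewHub idx H (false, l)) hm
    · have hl : l ≠ n := by
        rintro rfl
        rcases hvw with ⟨rfl, rfl⟩ | ⟨rfl, rfl⟩ <;> contradiction
      refine (hsep _ _ hl).trans ?_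
      simpa [skewHub, hne] using abs_skewDev_snd (skewHub idx H (true, l)) hn
  norm_hub {u v} h := by
    have e := norm_fin_three_le (x := skewHub idx H u - skewHub idx H v) (norm_nonneg _) |>.1 le_rfl
    have := abs_of_nonneg (by linarith : 0 ≤ H)
    rcases u with ⟨_ | _, m⟩ <;> rcases v with ⟨_ | _, n⟩
    · simp at h
      exact (hsep _ _ h).trans (by simpa [skewHub] using e.2.1)
    · exact h1.trans (by simpa [skewHub, this] using e.1)
    · exact h1.trans (by simpa [skewHub, this] using e.1)
    · simp at h
      exact (hsep _ _ h).trans (by simpa [skewHub] using e.2.2)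

/-- The incidence graph of the lines `b + d = a * c` of an affine plane over `ZMod p`. -/
def incidenceGraph (p : ℕ) : SimpleGraph (Bool × (ZMod p × ZMod p)) where
  Adj v w := v.1 ≠ w.1 ∧ v.2.2 + w.2.2 = v.2.1 * w.2.1
  symm := ⟨fun v w h => ⟨h.1.symm, by rw [add_comm, h.2, mul_comm]⟩⟩
  loopless := ⟨fun v h => h.1 rfl⟩

theorem incidenceGraph_square_free {p : ℕ} [Fact p.Prime] {u v w z : Bool × (ZMod p × ZMod p)}
    (h1 : (incidenceGraph p).Adj v w) (h2 : (incidenceGraph p).Adj v z)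
    (h3 : (incidenceGraph p).Adj u w) (h4 : (incidenceGraph p).Adj u z) (hwz : w ≠ z) :
    u = v := by
  obtain ⟨v1, v2, v3⟩ := v
  obtain ⟨u1, u2, u3⟩ := u
  obtain ⟨w1, w2, w3⟩ := w
  obtain ⟨z1, z2, z3⟩ := z
  simp only [incidenceGraph] at h1 h2 h3 h4
  have hb : ∀ a b c : Bool, a ≠ b → a ≠ c → b = c := by decide
  have hwz1 : w1 = z1 := hb _ _ _ h1.1 h2.1
  have huv1 : u1 = v1 := hb _ _ _ h3.1.symm h1.1.symm
  subst hwz1 huv1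
  have hprod : (u2 - v2) * (w2 - z2) = 0 := by
    linear_combination h1.2 - h2.2 - h3.2 + h4.2
  rcases mul_eq_zero.1 hprod with h | h
  · obtain rfl := sub_eq_zero.1 h
    have : u3 = v3 := by linear_combination h3.2 - h1.2
    rw [this]
  · obtain rfl := sub_eq_zero.1 h
    refine absurd ?_ hwz
    have : w3 = z3 := by linear_combination h1.2 - h2.2
    rw [this]

theorem incidenceGraph_degree {p k : ℕ} (hk : k < p) (v : Bool × (ZMod p × ZMod p)) :
    ∃ n : Fin (k + 1) → Bool × (ZMod p × ZMod p), Function.Injective n ∧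
      ∀ j, (incidenceGraph p).Adj v (n j) := by
  refine ⟨fun j => (!v.1, ((j : ℕ), v.2.1 * (j : ℕ) - v.2.2)), fun i j hij => ?_, fun j => ?_⟩
  · have h1 : ((i : ℕ) : ZMod p) = (j : ℕ) := congrArg (fun w => w.2.1) hij
    have := (ZMod.natCast_eq_natCast_iff' _ _ _).1 h1
    rw [Nat.mod_eq_of_lt (by omega), Nat.mod_eq_of_lt (by omega)] at this
    exact Fin.ext this
  · simp [incidenceGraph]

/-- An enumeration of the square of `ZMod p`. -/
def gridIndex (p : ℕ) (m : ZMod p × ZMod p) : ℕ := m.1.val * p + m.2.val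

theorem gridIndex_injective (p : ℕ) [NeZero p] : Function.Injective (gridIndex p) := by
  intro m n h
  have h1 := congrArg (· / p) h
  have h2 := congrArg (· % p) h
  have hp := Nat.pos_of_neZero p
  simp only [gridIndex, mul_comm _ p, Nat.mul_add_div hp, Nat.mul_add_mod,
    Nat.div_eq_of_lt (ZMod.val_lt _), Nat.mod_eq_of_lt (ZMod.val_lt _), add_zero] at h1 h2
  exact Prod.ext (ZMod.val_injective p h1) (ZMod.val_injective p h2)

theorem gridIndex_le (p : ℕ) [NeZero p] (m : ZMod p × ZMod p) : gridIndex p m ≤ p ^ 2 := by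
  have h1 := ZMod.val_lt m.1
  have h2 := ZMod.val_lt m.2
  rw [gridIndex]
  nlinarith

theorem exists_layout (k : ℕ) : ∃ (V : Type) (_ : Finite V) (_ : Nonempty V)
    (G : SimpleGraph V) (_ : Layout G),
    ∀ v, ∃ n : Fin (k + 1) → V, Function.Injective n ∧ ∀ j, G.Adj v (n j) := by
  obtain ⟨p, hk, hp⟩ := Nat.exists_infinite_primes (k + 1)
  have : Fact p.Prime := ⟨hp⟩
  refine ⟨_, inferInstance, inferInstance, incidenceGraph p,
    skewLayout (idx := fun m => (gridIndex p m : ℝ)) (H := (p : ℝ) ^ 2) ?_ (fun m => ?_)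
      (fun m => ?_) (fun m n hmn => ?_) _ (fun h => h.1) incidenceGraph_square_free,
    incidenceGraph_degree hk⟩
  · exact one_le_pow₀ (by exact_mod_cast hp.one_le)
  · positivity
  · exact_mod_cast gridIndex_le p m
  · have h : (gridIndex p m : ℤ) - gridIndex p n ≠ 0 :=
      sub_ne_zero.2 fun h => hmn (gridIndex_injective p (by exact_mod_cast h))
    exact_mod_cast Int.one_le_abs h

end Concrete

section Compactification

variable {E : Type}

/-- The extension by zero of a function to the one-point compactification. -/
def zeroExt (h : E → ℝ) (z : OnePoint E) : ℝ := z.elim 0 h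

@[simp] theorem zeroExt_coe (h : E → ℝ) (x : E) : zeroExt h (x : OnePoint E) = h x := rfl

@[simp] theorem zeroExt_infty (h : E → ℝ) : zeroExt h OnePoint.infty = 0 := rfl

variable [NormedAddCommGroup E]

/-- A Lipschitz function of bounded support whose Lipschitz constant is small enough for it to
remain `1`-Lipschitz after inversion in the unit sphere. -/
def IsBump (h : E → ℝ) : Prop :=
  ∃ l R : ℝ, 0 ≤ l ∧ 1 ≤ R ∧ l * R ^ 2 ≤ 1 ∧ (∀ x y, |h x - h y| ≤ l * ‖x - y‖) ∧
    ∀ x, R ≤ ‖x‖ → h x = 0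

namespace IsBump

theorem abs_sub_le {h : E → ℝ} (hh : IsBump h) (x y : E) : |h x - h y| ≤ ‖x - y‖ := by
  obtain ⟨l, R, hl, hR, hlR, hL, -⟩ := hh
  exact (hL x y).trans (mul_le_of_le_one_left (norm_nonneg _)
    ((le_mul_of_one_le_right hl (one_le_pow₀ hR)).trans hlR))

theorem continuous {h : E → ℝ} (hh : IsBump h) : Continuous h := by
  have : LipschitzWith 1 h := LipschitzWith.of_dist_le_mul fun x y => by
    simpa [Real.dist_eq, dist_eq_norm] using hh.abs_sub_le x y
  exact this.continuous

theorem continuous_zeroExt [ProperSpace E] {h : E → ℝ} (hh : IsBump h) :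
    Continuous (zeroExt h) := by
  refine (OnePoint.continuous_iff _).2 ⟨?_, hh.continuous⟩
  obtain ⟨l, R, -, -, -, -, hR⟩ := hh
  rw [Filter.coclosedCompact_eq_cocompact]
  refine tendsto_const_nhds.congr' ?_
  filter_upwards [(tendsto_norm_cocompact_atTop (E := E)).eventually_ge_atTop R] with x hx
  simp [hR x hx]

variable [NormedSpace ℝ E]

theorem abs_inversion_sub_le {h : E → ℝ} (hh : IsBump h) {ω : E} (hω : ‖ω‖ = 1) (s t : ℝ) :
    |zeroExt h (if s ≤ 0 then OnePoint.infty else ((s⁻¹ • ω : E) : OnePoint E)) -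
      zeroExt h (if t ≤ 0 then OnePoint.infty else ((t⁻¹ • ω : E) : OnePoint E))| ≤ |s - t| := by
  obtain ⟨l, R, hl, hR, hlR, hL, h0⟩ := hh
  have hR0 : 0 < R := by linarith
  have key : ∀ u : ℝ, zeroExt h (if u ≤ 0 then OnePoint.infty else ((u⁻¹ • ω : E) : OnePoint E)) =
      h ((max u R⁻¹)⁻¹ • ω) := by
    intro u
    have hz : ∀ v : ℝ, 0 < v → v ≤ R⁻¹ → h (v⁻¹ • ω) = 0 := by
      intro v hv hvR
      refine h0 _ ?_
      rw [norm_smul, hω, mul_one, Real.norm_of_nonneg (inv_nonneg.2 hv.le)]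
      exact (le_inv_comm₀ hv hR0).1 hvR
    have hR1 : 0 < R⁻¹ := inv_pos.2 hR0
    split_ifs with hu
    · rw [max_eq_right (by linarith), hz _ hR1 le_rfl, zeroExt_infty]
    · rw [zeroExt_coe]
      rcases le_total u R⁻¹ with hu' | hu'
      · rw [max_eq_right hu', hz _ hR1 le_rfl, hz _ (not_le.1 hu) hu']
      · rw [max_eq_left hu']
  rw [key, key]
  set a := max s R⁻¹ with ha
  set b := max t R⁻¹ with hb
  have hR1 : 0 < R⁻¹ := inv_pos.2 hR0
  have ha1 : R⁻¹ ≤ a := le_max_right _ _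
  have hb1 : R⁻¹ ≤ b := le_max_right _ _
  have ha0 : 0 < a := hR1.trans_le ha1
  have hb0 : 0 < b := hR1.trans_le hb1
  refine (hL _ _).trans ?_
  rw [← sub_smul, norm_smul, hω, mul_one, Real.norm_eq_abs]
  have h1 : a⁻¹ - b⁻¹ = (b - a) * (a⁻¹ * b⁻¹) := by field_simp
  have h2 : a⁻¹ ≤ R := inv_le_of_inv_le₀ hR0 ha1
  have h3 : b⁻¹ ≤ R := inv_le_of_inv_le₀ hR0 hb1
  have h4 : a⁻¹ * b⁻¹ ≤ R ^ 2 := by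
    rw [sq]
    exact mul_le_mul h2 h3 (inv_nonneg.2 hb0.le) hR0.le
  have h5 : |b - a| ≤ |s - t| := by
    rw [abs_sub_comm]
    exact abs_max_sub_max_le_abs _ _ _
  rw [h1, abs_mul, abs_of_nonneg (by positivity : 0 ≤ a⁻¹ * b⁻¹)]
  calc l * (|b - a| * (a⁻¹ * b⁻¹)) = (l * (a⁻¹ * b⁻¹)) * |b - a| := by ring
    _ ≤ 1 * |b - a| := by
        refine mul_le_mul_of_nonneg_right (le_trans ?_ hlR) (abs_nonneg _)
        exact mul_le_mul_of_nonneg_left h4 hl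
    _ ≤ |s - t| := by rwa [one_mul]

end IsBump

variable [NormedSpace ℝ E] {ι : Type*} {F : ι → E → ℝ}

theorem joins_infty (hF : ∀ i, IsBump (F i)) {x : E} (hx : x ≠ 0) :
    Joins (fun i => zeroExt (F i)) ‖x‖⁻¹ OnePoint.infty (x : OnePoint E) := by
  have hx' : 0 < ‖x‖ := norm_pos_iff.2 hx
  refine ⟨by positivity, fun u => if u ≤ 0 then OnePoint.infty else
    ((u⁻¹ • (‖x‖⁻¹ • x) : E) : OnePoint E), by simp, ?_, fun i s t => ?_⟩
  · simp [hx'.not_ge, smul_smul, hx'.ne']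
  · exact (hF i).abs_inversion_sub_le (by simp [norm_smul, hx'.ne']) s t

theorem joins_of_segment {C : ℝ} (hC : 0 < C) {x y : E}
    (h : ∀ i, ∀ s ∈ Icc (0 : ℝ) 1, ∀ t ∈ Icc (0 : ℝ) 1,
      |F i (x + s • (y - x)) - F i (x + t • (y - x))| ≤ C * |s - t|) :
    Joins (fun i => zeroExt (F i)) C (x : OnePoint E) (y : OnePoint E) :=
  Joins.of_unitInterval hC (fun t => ((x + t • (y - x) : E) : OnePoint E)) (by simp) (by simp) h

theorem joins_coe (hF : ∀ i, IsBump (F i)) (x y : E) :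
    Joins (fun i => zeroExt (F i)) ‖x - y‖ (x : OnePoint E) (y : OnePoint E) := by
  by_cases hxy : x = y
  · subst hxy
    simpa using Joins.refl _
  · refine joins_of_segment (norm_pos_iff.2 (sub_ne_zero.2 hxy)) fun i s _ t _ =>
      ((hF i).abs_sub_le _ _).trans_eq ?_
    rw [add_sub_add_left_eq_sub, ← sub_smul, norm_smul, norm_sub_rev y x, mul_comm,
      Real.norm_eq_abs]

theorem exists_geodesic_metric_onePoint [ProperSpace E] [Nontrivial E]
    (hF : ∀ i, IsBump (F i)) (hsep : ∀ x, ∃ i, 0 < F i x ∧ ∀ y, F i y = F i x → y = x) :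
    ∃ (Y : Type) (_ : MetricSpace Y) (e : OnePoint E ≃ₜ Y),
      GameSpaceD Y (fun x y => dist x y) ∧
      (∀ i x y, |F i x - F i y| ≤ dist (e x) (e y)) ∧
      (∀ i x, |F i x| ≤ dist (e OnePoint.infty) (e x)) ∧
      ∀ C > 0, ∀ x y : E, (∀ i, ∀ s ∈ Icc (0 : ℝ) 1, ∀ t ∈ Icc (0 : ℝ) 1,
        |F i (x + s • (y - x)) - F i (x + t • (y - x))| ≤ C * |s - t|) → dist (e x) (e y) ≤ C := by
  have hinf : ∀ z : OnePoint E, ∃ C, Joins (fun i => zeroExt (F i)) C OnePoint.infty z := by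
    intro z
    induction z using OnePoint.rec with
    | infty => exact ⟨0, Joins.refl _⟩
    | coe x =>
      obtain ⟨v, hv⟩ := exists_ne (0 : E)
      exact ⟨_, (joins_infty hF hv).trans (joins_coe hF v x)⟩
  have hsep' : ∀ z w, (∀ i, zeroExt (F i) z = zeroExt (F i) w) → z = w := by
    intro z w h
    induction z using OnePoint.rec with
    | infty =>
      induction w using OnePoint.rec with
      | infty => rfl
      | coe y =>
        obtain ⟨i, hi, -⟩ := hsep y
        exact absurd (h i) hi.ne
    | coe x =>
      obtain ⟨i, hi, hx⟩ := hsep x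
      induction w using OnePoint.rec with
      | infty => exact absurd (h i) hi.ne'
      | coe y => rw [hx y (h i).symm]
  have hconn : ∀ z w, ∃ C, Joins (fun i => zeroExt (F i)) C z w := by
    intro z w
    obtain ⟨A, hA⟩ := hinf z
    obtain ⟨B, hB⟩ := hinf w
    exact ⟨_, hA.symm.trans hB⟩
  have hloc : ∀ z, ∀ ε > 0, ∀ᶠ w in 𝓝 z, Joins (fun i => zeroExt (F i)) ε z w := by
    intro z ε hε
    induction z using OnePoint.rec with
    | infty =>
      rw [OnePoint.nhds_infty_eq, eventually_sup, eventually_pure, eventually_map,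
        Filter.coclosedCompact_eq_cocompact]
      refine ⟨?_, (Joins.refl _).mono hε.le⟩
      filter_upwards [(tendsto_norm_cocompact_atTop (E := E)).eventually_ge_atTop ε⁻¹] with x hx
      have hx' : 0 < ‖x‖ := (inv_pos.2 hε).trans_le hx
      exact (joins_infty hF (norm_pos_iff.1 hx')).mono (inv_le_of_inv_le₀ hε hx)
    | coe x =>
      rw [OnePoint.nhds_coe_eq, eventually_map]
      filter_upwards [Metric.ball_mem_nhds x hε] with y hy
      refine (joins_coe hF x y).mono ?_
      rw [norm_sub_rev, ← dist_eq_norm]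
      exact (Metric.mem_ball.1 hy).le
  obtain ⟨Y, _, e, hY, hl, hu⟩ := exists_geodesic_metric
    (fun i => (hF i).continuous_zeroExt) hsep' hconn hloc
  refine ⟨Y, _, e, hY, fun i x y => hl i x y, fun i x => ?_, fun C hC x y h =>
    hu _ _ _ (joins_of_segment hC h)⟩
  simpa using hl i OnePoint.infty x

end Compactification

section Assembly

theorem exists_separated_reals {ρ : ℕ → ℝ} (hρ : ∀ i, 0 ≤ ρ i) :
    ∃ t : ℕ → ℝ, ∀ i k, i ≠ k → ρ i + ρ k ≤ |t i - t k| := by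
  have key : ∀ i k, i < k → ρ i + ρ k ≤
      ((∑ j ∈ Finset.range k, 2 * ρ j) + ρ k) - ((∑ j ∈ Finset.range i, 2 * ρ j) + ρ i) := by
    intro i k hik
    have h1 : ∑ j ∈ Finset.range (i + 1), 2 * ρ j ≤ ∑ j ∈ Finset.range k, 2 * ρ j :=
      Finset.sum_le_sum_of_subset_of_nonneg (by simpa using hik)
        fun j _ _ => by linarith [hρ j]
    rw [Finset.sum_range_succ] at h1
    linarith
  refine ⟨fun k => (∑ j ∈ Finset.range k, 2 * ρ j) + ρ k, fun i k hik => ?_⟩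
  rcases lt_or_gt_of_ne hik with h | h
  · rw [abs_sub_comm]
    exact (key i k h).trans (le_abs_self _)
  · rw [add_comm]
    exact (key k i h).trans (le_abs_self _)

theorem exists_separated {ρ : ℕ → ℝ} (hρ : ∀ i, 0 ≤ ρ i) :
    ∃ T : ℕ → Fin 3 → ℝ, ∀ i k, i ≠ k → ρ i + ρ k ≤ ‖T i - T k‖ := by
  obtain ⟨t, ht⟩ := exists_separated_reals hρ
  refine ⟨fun i _ => t i, fun i k hik => (ht i k hik).trans ?_⟩
  exact norm_le_pi_norm (fun _ : Fin 3 => t i - t k) 0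

variable {E : Type} [NormedAddCommGroup E]

theorem isBump_scaled_translate {q : E → ℝ} {L R s : ℝ} {T : E} (hL : 0 ≤ L) (hR : 0 ≤ R)
    (hlip : ∀ x y, |q x - q y| ≤ L * ‖x - y‖) (hfar : ∀ x, R ≤ ‖x‖ → q x = 0) (hs : 0 ≤ s)
    (hsL : s * L * (‖T‖ + R + 1) ^ 2 ≤ 1) : IsBump fun x => s * q (x - T) := by
  refine ⟨s * L, ‖T‖ + R + 1, by positivity, by linarith [norm_nonneg T], hsL, fun x y => ?_,
    fun x hx => ?_⟩
  · rw [← mul_sub, abs_mul, abs_of_nonneg hs, mul_assoc]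
    exact mul_le_mul_of_nonneg_left (by simpa using hlip (x - T) (y - T)) hs
  · exact mul_eq_zero_of_right s (hfar _ (by linarith [norm_le_norm_sub_add x T]))

/-- The cone of height and radius one over the unit ball. -/
def cone (x : E) : ℝ := max 0 (1 - ‖x‖)

theorem abs_cone_sub_le (x y : E) : |cone x - cone y| ≤ ‖x - y‖ := by
  rw [cone, cone, max_comm, max_comm 0]
  refine (abs_max_sub_max_le_abs _ _ _).trans ?_
  rw [sub_sub_sub_cancel_left, abs_sub_comm]
  exact abs_norm_sub_norm_le x y

theorem cone_eq_zero {x : E} (h : 1 ≤ ‖x‖) : cone x = 0 :=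
  max_eq_left (by linarith)

theorem cone_eq_one {x : E} (h : cone x = 1) : x = 0 := by
  rw [← norm_eq_zero]
  rcases max_choice 0 (1 - ‖x‖) with h1 | h1 <;> rw [cone, h1] at h <;> linarith

theorem cone_zero : cone (0 : E) = 1 := by simp [cone]

theorem exists_game_space_of_gadgets {V : ℕ → Type} (q : ∀ k, V k → (Fin 3 → ℝ) → ℝ)
    {L R : ℕ → ℝ} (hL : ∀ k, 0 ≤ L k) (hR : ∀ k, 0 ≤ R k)
    (hlip : ∀ k w x y, |q k w x - q k w y| ≤ L k * ‖x - y‖)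
    (hfar : ∀ k w x, R k ≤ ‖x‖ → q k w x = 0) :
    ∃ (Y : Type) (_ : MetricSpace Y) (e : OnePoint (Fin 3 → ℝ) ≃ₜ Y) (T : ℕ → Fin 3 → ℝ)
      (s : ℕ → ℝ), (∀ k, 0 < s k) ∧ GameSpaceD Y (fun x y => dist x y) ∧
      (∀ k w x y, s k * |q k w x - q k w y| ≤
        dist (e ((T k + x : Fin 3 → ℝ))) (e ((T k + y : Fin 3 → ℝ)))) ∧
      (∀ k w x, s k * |q k w x| ≤ dist (e OnePoint.infty) (e ((T k + x : Fin 3 → ℝ)))) ∧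
      ∀ k, ∀ C > 0, ∀ x y, ‖x‖ ≤ R k → ‖y‖ ≤ R k → Tame (q k) C x y →
        dist (e ((T k + x : Fin 3 → ℝ))) (e ((T k + y : Fin 3 → ℝ))) ≤ s k * C := by
  obtain ⟨T, hT⟩ := exists_separated (ρ := fun k => R k + 1) fun k => by linarith [hR k]
  let s : ℕ → ℝ := fun k => ((1 + L k) * (‖T k‖ + R k + 1) ^ 2)⁻¹
  have hρ : ∀ k, 0 < ‖T k‖ + R k + 1 := fun k => by linarith [hR k, norm_nonneg (T k)]
  have hs : ∀ k, 0 < s k := fun k =>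
    inv_pos.2 (mul_pos (by linarith [hL k]) (pow_pos (hρ k) 2))
  have hsL : ∀ k, s k * L k * (‖T k‖ + R k + 1) ^ 2 ≤ 1 := by
    intro k
    have h1 : 0 < (1 + L k) * (‖T k‖ + R k + 1) ^ 2 := inv_pos.1 (hs k)
    calc s k * L k * (‖T k‖ + R k + 1) ^ 2
        ≤ s k * ((1 + L k) * (‖T k‖ + R k + 1) ^ 2) := by
          rw [mul_assoc]
          refine mul_le_mul_of_nonneg_left ?_ (hs k).le
          exact mul_le_mul_of_nonneg_right (by linarith) (sq_nonneg _)
      _ = 1 := inv_mul_cancel₀ h1.ne'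
  have hε : ∀ y : Fin 3 → ℝ, ∃ ε : ℝ, 0 < ε ∧ ε * 1 * (‖y‖ + 1 + 1) ^ 2 ≤ 1 ∧
      ∀ k, ‖y - T k‖ < R k + 1 → ε ≤ s k := by
    intro y
    have hy : 0 < (‖y‖ + 1 + 1) ^ 2 := by positivity
    by_cases h : ∃ k, ‖y - T k‖ < R k + 1
    · obtain ⟨k, hk⟩ := h
      refine ⟨min (s k) ((‖y‖ + 1 + 1) ^ 2)⁻¹, lt_min (hs k) (inv_pos.2 hy), ?_, fun j hj => ?_⟩
      · rw [mul_one, ← le_div_iff₀ hy, one_div]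
        exact min_le_right _ _
      · have hjk : j = k := by
          by_contra hne
          have h1 := hT j k hne
          have h2 := norm_sub_le_norm_sub_add_norm_sub (T j) y (T k)
          rw [norm_sub_rev (T j) y] at h2
          linarith
        subst hjk
        exact min_le_left _ _
    · refine ⟨((‖y‖ + 1 + 1) ^ 2)⁻¹, inv_pos.2 hy, ?_, fun k hk => absurd ⟨k, hk⟩ h⟩
      rw [mul_one, inv_mul_cancel₀ hy.ne']
  choose ε hε0 hε1 hε2 using hε
  let F : (Σ k, V k) ⊕ (Fin 3 → ℝ) → (Fin 3 → ℝ) → ℝ :=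
    Sum.elim (fun p x => s p.1 * q p.1 p.2 (x - T p.1)) fun y x => ε y * cone (x - y)
  have hF : ∀ i, IsBump (F i) := by
    rintro (⟨k, w⟩ | y)
    · exact isBump_scaled_translate (hL k) (hR k) (hlip k w) (hfar k w) (hs k).le (hsL k)
    · exact isBump_scaled_translate zero_le_one zero_le_one
        (by simpa using abs_cone_sub_le) (fun _ => cone_eq_zero) (hε0 y).le (hε1 y)
  obtain ⟨Y, _, e, hY, hl, hl', hu⟩ := exists_geodesic_metric_onePoint hF fun x =>
    ⟨Sum.inr x, by simp [F, cone_zero, hε0], fun y hy => by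
      have : cone (y - x) = 1 := by simpa [F, cone_zero, (hε0 x).ne'] using hy
      exact sub_eq_zero.1 (cone_eq_one this)⟩
  refine ⟨Y, _, e, T, s, hs, hY, fun k w x y => ?_, fun k w x => ?_,
    fun k C hC x y hx hy hxy => hu _ (mul_pos (hs k) hC) _ _ ?_⟩
  · have := hl (Sum.inl ⟨k, w⟩) (T k + x) (T k + y)
    simpa [F, ← mul_sub, abs_mul, abs_of_pos (hs k)] using this
  · have := hl' (Sum.inl ⟨k, w⟩) (T k + x)
    simpa [F, abs_mul, abs_of_pos (hs k)] using this
  · have hseg : ∀ t : ℝ, T k + x + t • (T k + y - (T k + x)) = T k + (x + t • (y - x)) := by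
      intro t
      rw [add_sub_add_left_eq_sub, add_assoc]
    have hnorm : ∀ t ∈ Icc (0 : ℝ) 1, ‖x + t • (y - x)‖ ≤ R k := by
      intro t ht
      have : x + t • (y - x) ∈ Metric.closedBall (0 : Fin 3 → ℝ) (R k) :=
        (convex_closedBall _ _).add_smul_sub_mem (by simpa using hx) (by simpa using hy) ht
      simpa using this
    have hpos : ∀ a b : ℝ, 0 ≤ s k * C * |a - b| := fun a b =>
      mul_nonneg (mul_pos (hs k) hC).le (abs_nonneg _)
    rintro (⟨j, w⟩ | z) a ha b hb
    · simp only [F, Sum.elim_inl, hseg]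
      by_cases hjk : j = k
      · subst hjk
        rw [add_sub_cancel_left, add_sub_cancel_left, ← mul_sub, abs_mul, abs_of_pos (hs j),
          mul_assoc]
        exact mul_le_mul_of_nonneg_left (hxy.2 w a ha b hb) (hs j).le
      · have hz : ∀ t ∈ Icc (0 : ℝ) 1, q j w (T k + (x + t • (y - x)) - T j) = 0 := by
          intro t ht
          refine hfar j w _ ?_
          have h1 := hT k j (Ne.symm hjk)
          have h2 := hnorm t ht
          have h3 := norm_sub_le (T k + (x + t • (y - x)) - T j) (x + t • (y - x))
          rw [show T k + (x + t • (y - x)) - T j - (x + t • (y - x)) = T k - T j by abel] at h3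
          linarith
        rw [hz a ha, hz b hb, sub_self, abs_zero]
        exact hpos a b
    · simp only [F, Sum.elim_inr, hseg]
      rw [← mul_sub, abs_mul, abs_of_pos (hε0 z)]
      by_cases hzk : ‖z - T k‖ < R k + 1
      · rw [mul_assoc]
        refine mul_le_mul (hε2 z k hzk) ((abs_cone_sub_le _ _).trans ?_) (abs_nonneg _) (hs k).le
        rw [sub_sub_sub_cancel_right, add_sub_add_left_eq_sub, add_sub_add_left_eq_sub,
          ← sub_smul, norm_smul, norm_sub_rev y x, mul_comm, Real.norm_eq_abs]
        exact mul_le_mul_of_nonneg_right hxy.1 (abs_nonneg _)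
      · have hz : ∀ t ∈ Icc (0 : ℝ) 1, cone (T k + (x + t • (y - x)) - z) = 0 := by
          intro t ht
          refine cone_eq_zero ?_
          have h2 := hnorm t ht
          have h3 := norm_sub_le (x + t • (y - x)) (T k + (x + t • (y - x)) - z)
          rw [show x + t • (y - x) - (T k + (x + t • (y - x)) - z) = z - T k by abel] at h3
          linarith [not_lt.1 hzk]
        rw [hz a ha, hz b hb, sub_self, abs_zero, mul_zero]
        exact hpos a b

end Assembly

section Gadget

variable {V : Type} [Finite V] {G : SimpleGraph V} {K : Layout G} {Y : Type*} [MetricSpace Y]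

/-- A space in which the bumps of a layout are, up to a scale factor `s`, lower bounds for the
distance and `Tame` gives upper bounds allows the robber to run along the hubs. -/
theorem not_copsWinWith_of_layout {s : ℝ} (hs : 0 < s) (e : OnePoint (Fin 3 → ℝ) ≃ₜ Y)
    (T : Fin 3 → ℝ)
    (hl : ∀ w x y, s * |K.bump w x - K.bump w y| ≤
      dist (e ((T + x : Fin 3 → ℝ))) (e ((T + y : Fin 3 → ℝ))))
    (hl' : ∀ w x, s * |K.bump w x| ≤ dist (e OnePoint.infty) (e ((T + x : Fin 3 → ℝ))))
    (hu : ∀ C > 0, ∀ x y, ‖x‖ ≤ 2 * K.H + 2 → ‖y‖ ≤ 2 * K.H + 2 → Tame K.bump C x y →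
        dist (e ((T + x : Fin 3 → ℝ))) (e ((T + y : Fin 3 → ℝ))) ≤ s * C)
    [Nonempty V] {k : ℕ}
    (hdeg : ∀ v, ∃ n : Fin (k + 1) → V, Function.Injective n ∧ ∀ j, G.Adj v (n j)) :
    ¬ CopsWinWith Y (fun x y => dist x y) k := by
  have hH := K.one_le
  have hself : ∀ w, |K.bump w (K.c w)| = K.H + 1 / 4 := fun w => by
    rw [Layout.bump_self, abs_of_pos (by linarith)]
  have hc : ∀ v, ‖K.c v‖ ≤ 2 * K.H + 2 := fun v => (K.norm_c_le v).trans (by linarith)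
  obtain ⟨v0⟩ := ‹Nonempty V›
  refine not_copsWinWith (Y := Y) (s := s * K.H) (a := s / 4)
    (y0 := e OnePoint.infty) ⟨dist_self, fun x y => eq_of_dist_eq_zero, dist_comm, dist_triangle⟩
    (by positivity) (by positivity) (range fun v => e ((T + K.c v : Fin 3 → ℝ))) ⟨v0, rfl⟩ ?_ ?_
  · refine le_trans ?_ (hl' v0 (K.c v0))
    rw [hself]
    nlinarith
  · rintro _ ⟨v, rfl⟩ x hx
    obtain ⟨n, hn, hadj⟩ := hdeg v
    suffices h : ∃ j, ∀ i, s * (K.H + 1 / 4) ≤ dist (x i) (e ((T + K.c (n j) : Fin 3 → ℝ))) by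
      obtain ⟨j, hj⟩ := h
      exact ⟨_, ⟨n j, rfl⟩, hu _ (by linarith) _ _ (hc _) (hc _) (Layout.tame_edge (hadj j)),
        fun i => le_of_eq_of_le (by ring) (hj i)⟩
    by_contra! h
    choose f hf using h
    obtain ⟨j, j', hjj', hff⟩ := Fintype.exists_ne_map_eq_of_card_lt f (by simp)
    have hx' : ∀ j, ∃ z : Fin 3 → ℝ, x (f j) = e ((T + z : Fin 3 → ℝ)) ∧
        0 < K.bump (n j) z := by
      intro j
      obtain ⟨y, hy⟩ := e.surjective (x (f j))
      have h1 := hf j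
      rw [← hy] at h1
      induction y using OnePoint.rec with
      | infty =>
        have h2 := hl' (n j) (K.c (n j))
        rw [hself] at h2
        linarith
      | coe y =>
        refine ⟨y - T, by rw [add_sub_cancel, hy], ?_⟩
        have h2 := hl (n j) (y - T) (K.c (n j))
        rw [add_sub_cancel] at h2
        by_contra! h3
        rw [le_antisymm h3 (Layout.bump_nonneg _ _), zero_sub, abs_neg, hself] at h2
        linarith
    obtain ⟨z, hz, hzj⟩ := hx' j
    obtain ⟨z', hz', hzj'⟩ := hx' j'
    have hzz : z = z' := by
      rw [← hff, hz] at hz'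
      simpa using hz'
    rw [← hzz] at hzj'
    have hlt := Layout.norm_lt_of_bump_pos (hadj j) (hadj j') (fun h => hjj' (hn h)) hzj hzj'
    have ha := hx (f j)
    rw [hz] at ha
    refine absurd ha (not_le.2 ?_)
    rcases eq_or_ne z (K.c v) with rfl | hne
    · rw [dist_self]
      positivity
    · have hpos : 0 < ‖z - K.c v‖ := norm_pos_iff.2 (sub_ne_zero.2 hne)
      have h1 : ‖z‖ ≤ 2 * K.H + 2 := by
        linarith [norm_le_norm_sub_add z (K.c v), K.norm_c_le v]
      have h2 := hu _ hpos _ _ (hc v) h1 (Layout.tame_radial hlt.le)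
      rw [dist_comm]
      nlinarith

end Gadget

/-- Corollary `cor inf` of the paper. There is a game space `(X,d)`
homeomorphic to the `3`-sphere with infinite cop number: for every `k`, `k` cops do not
have a winning strategy on `X`. -/
theorem exists_sphere3_infinite_cop_number :
    ∃ (X : Type) (_ : MetricSpace X),
      GameSpaceD X (fun x y => dist x y) ∧
      Nonempty (X ≃ₜ ↥(Metric.sphere (0 : EuclideanSpace ℝ (Fin 4)) 1)) ∧
      copNumber X (fun x y => dist x y) = ⊤ ∧
      (∀ k : ℕ, ¬ CopsWinWith X (fun x y => dist x y) k) := by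
  choose V hfin hne G K hdeg using exists_layout
  have hH := fun k => (K k).one_le
  obtain ⟨Y, _, e, T, s, hs, hY, hl, hl', hu⟩ := exists_game_space_of_gadgets
    (fun k => (K k).bump) (L := fun k => 1 + 32 * (K k).H) (R := fun k => 2 * (K k).H + 2)
    (fun k => by linarith [hH k]) (fun k => by linarith [hH k])
    (fun k => Layout.bump_lipschitz) (fun k w x => Layout.bump_eq_zero_of_far)
  have hwin : ∀ k, ¬ CopsWinWith Y (fun x y => dist x y) k := fun k =>
    not_copsWinWith_of_layout (hs k) e (T k) (hl k) (hl' k) (hu k) (hdeg k)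
  exact ⟨Y, _, hY,
    ⟨e.symm.trans (onePointEquivSphereOfFinrankEq (ι := Fin 4) (V := Fin 3 → ℝ) (by simp))⟩,
    copNumber_eq_top hwin, hwin⟩
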